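/- arXiv:1509.00092 — 4 statements merged into one kernel-verified Lean document; each statement's English description precedes it below -/
import Mathlib

section
/- For every 0 < δ < 1 there exist constants c_δ ≥ 1, γ_δ > 0 and n_0 such that for every n ≥ n_0 there exist positive integers u, v and subsets S_{ij} ⊆ [n] (for i ∈ [u], j ∈ [v]) with Σ_{i,j}|S_{ij}| ≤ n^{c_δ}, such that the monotone depth-three function f(x) = ⋀_{i=1}^u ⋁_{j=1}^v ⋀_{k∈S_{ij}} x_k satisfies, for every integer t ≥ c_δ·(log₂ n)^4: (i) for every t-wise independent distribution 𝒟 on {0,1}^n, |Pr_{x∼𝒟}[f(x)=1] − 1/2| ≤ n^{−γ_δ}, and (ii) for every integer 1 ≤ q ≤ n^{1−δ}, I_{q,t}(f) ≤ c_δ·n^{−(1−δ)}·q. -/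
open Finset

-- Probability of event `E` under the distribution with weight function `D`.
open Classical in
noncomputable def dPr {α : Type*} [Fintype α] (D : α → ℝ) (E : α → Prop) : ℝ :=
  ∑ x, if E x then D x else 0

-- `D` is a `t`-wise independent distribution: every projection to ≤ `t` coordinates is uniform.
open Classical in
def kWiseIndep {ι : Type*} [Fintype ι] (D : (ι → Bool) → ℝ) (t : ℕ) : Prop :=
  ∀ I : Finset ι, I.card ≤ t → ∀ σ : ι → Bool,
    (∑ x : ι → Bool, if ∀ i ∈ I, x i = σ i then D x else 0) = (1/2 : ℝ) ^ I.card

/-- Monotone depth-3 (AND of ORs of ANDs) function given by subsets `S i j`. -/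
def Depth3 {n u v : ℕ} (S : Fin u → Fin v → Finset (Fin n)) (x : Fin n → Bool) : Prop :=
  ∀ i, ∃ j, ∀ k ∈ S i j, x k = true

/-- The event (on assignments to coordinates outside `Q`) that `F` is not determined. -/
def UndetC {n : ℕ} (F : (Fin n → Bool) → Prop) (Q : Finset (Fin n))
    (x : {i : Fin n // i ∉ Q} → Bool) : Prop :=
  ∃ y z : Fin n → Bool, (∀ i, ∀ h : i ∉ Q, y i = x ⟨i, h⟩) ∧
    (∀ i, ∀ h : i ∉ Q, z i = x ⟨i, h⟩) ∧ ¬(F y ↔ F z)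

/-- Uniform random permutations: the events `σ j ∈ V` are negatively correlated. -/
theorem card_perm_maps_le {Y : Type*} [Fintype Y] [DecidableEq Y] (V T : Finset Y) :
    #{σ : Equiv.Perm Y | ∀ j ∈ T, σ j ∈ V} * Fintype.card Y ^ #T ≤
      Fintype.card (Equiv.Perm Y) * #V ^ #T := by
  induction T using Finset.induction_on with
  | empty => simp [Finset.card_univ]
  | insert a T ha ih =>
    set N := #{σ : Equiv.Perm Y | ∀ j ∈ T, σ j ∈ V} with hN
    set N' := #{σ : Equiv.Perm Y | ∀ j ∈ insert a T, σ j ∈ V} with hN'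
    have hle : ∀ b : Y, N' ≤ #{σ : Equiv.Perm Y | (∀ j ∈ T, σ j ∈ V) ∧ σ b ∈ V} := by
      intro b
      by_cases hb : b ∈ T
      · refine Finset.card_le_card fun σ hσ => ?_
        simp only [Finset.mem_filter, Finset.mem_univ, true_and, Finset.mem_insert,
          forall_eq_or_imp] at hσ ⊢
        exact ⟨hσ.2, hσ.2 b hb⟩
      · refine Finset.card_le_card_of_injOn (fun σ => σ * Equiv.swap a b) ?_ ?_
        · intro σ hσ
          simp only [Finset.mem_coe, Finset.mem_filter, Finset.mem_univ, true_and,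
            Finset.mem_insert, forall_eq_or_imp] at hσ ⊢
          refine ⟨fun j hj => ?_, ?_⟩
          · rw [Equiv.Perm.mul_apply, Equiv.swap_apply_of_ne_of_ne]
            · exact hσ.2 j hj
            · rintro rfl; exact ha hj
            · rintro rfl; exact hb hj
          · simpa [Equiv.Perm.mul_apply] using hσ.1
        · intro σ _ τ _ h
          exact mul_right_cancel h
    have hsum : ∑ b : Y, #{σ : Equiv.Perm Y | (∀ j ∈ T, σ j ∈ V) ∧ σ b ∈ V} = N * #V := by
      simp_rw [Finset.card_filter, ite_and]
      rw [Finset.sum_comm, hN, Finset.card_filter, Finset.sum_mul]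
      refine Finset.sum_congr rfl fun σ _ => ?_
      split_ifs with h
      · rw [one_mul, ← Finset.card_filter]
        rw [← Finset.card_map σ.toEmbedding]
        congr 1
        ext y
        simp only [Finset.mem_map, Finset.mem_filter, Finset.mem_univ, true_and,
          Equiv.coe_toEmbedding]
        constructor
        · rintro ⟨b, hb, rfl⟩; exact hb
        · intro hy; exact ⟨σ.symm y, by simpa using hy, by simp⟩
      · simp
    have hmul : N' * Fintype.card Y ≤ N * #V := by
      rw [← hsum]
      calc N' * Fintype.card Y = ∑ _b : Y, N' := by simp [mul_comm]
        _ ≤ _ := Finset.sum_le_sum fun b _ => hle b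
    rw [Finset.card_insert_of_notMem ha]
    calc N' * Fintype.card Y ^ (#T + 1) = (N' * Fintype.card Y) * Fintype.card Y ^ #T := by ring
      _ ≤ (N * #V) * Fintype.card Y ^ #T := by gcongr
      _ = (N * Fintype.card Y ^ #T) * #V := by ring
      _ ≤ (Fintype.card (Equiv.Perm Y) * #V ^ #T) * #V := by gcongr
      _ = _ := by ring

theorem sum_perm_pow_card_le {Y : Type*} [Fintype Y] [DecidableEq Y] [Nonempty Y]
    (V A : Finset Y) {y : ℝ} (hy : 0 ≤ y) :
    ∑ σ : Equiv.Perm Y, (1 + y) ^ #{j ∈ A | σ j ∈ V} ≤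
      Fintype.card (Equiv.Perm Y) * (1 + y * #V / Fintype.card Y) ^ #A := by
  have hY : (0 : ℝ) < Fintype.card Y := by exact_mod_cast Fintype.card_pos
  have hexp : ∀ (z : ℝ) (B : Finset Y), (1 + z) ^ #B = ∑ T ∈ B.powerset, z ^ #T := by
    intro z B
    rw [add_comm, ← Finset.sum_pow_mul_eq_add_pow]
    simp
  have h1 : ∀ σ : Equiv.Perm Y, (1 + y) ^ #{j ∈ A | σ j ∈ V} =
      ∑ T ∈ A.powerset, if ∀ j ∈ T, σ j ∈ V then y ^ #T else 0 := by
    intro σ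
    rw [hexp, ← Finset.sum_filter]
    refine Finset.sum_congr ?_ fun _ _ => rfl
    ext T
    simp only [Finset.mem_powerset, Finset.mem_filter, Finset.subset_iff]
    exact ⟨fun h => ⟨fun _ hx => (h hx).1, fun _ hx => (h hx).2⟩,
      fun h x hx => ⟨h.1 hx, h.2 x hx⟩⟩
  simp_rw [h1]
  rw [Finset.sum_comm, hexp, Finset.mul_sum]
  refine Finset.sum_le_sum fun T _ => ?_
  rw [← Finset.sum_filter, Finset.sum_const, nsmul_eq_mul]
  have h2 : (#{σ : Equiv.Perm Y | ∀ j ∈ T, σ j ∈ V} : ℝ) * (Fintype.card Y : ℝ) ^ #T ≤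
      Fintype.card (Equiv.Perm Y) * (#V : ℝ) ^ #T := by
    exact_mod_cast card_perm_maps_le V T
  rw [div_pow, mul_pow, mul_div_assoc', le_div_iff₀ (by positivity)]
  calc _ = y ^ #T * ((#{σ : Equiv.Perm Y | ∀ j ∈ T, σ j ∈ V} : ℝ) *
        (Fintype.card Y : ℝ) ^ #T) := by ring
    _ ≤ y ^ #T * (Fintype.card (Equiv.Perm Y) * (#V : ℝ) ^ #T) := by gcongr
    _ = _ := by ring

theorem sum_pi_update {κ P : Type*} [Fintype κ] [DecidableEq κ] [Fintype P]
    (F : (κ → P) → ℝ) (a : κ) :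
    ∑ π : κ → P, ∑ σ : P, F (Function.update π a σ) = Fintype.card P * ∑ π, F π := by
  classical
  have e := fun G : (κ → P) → ℝ => (Equiv.sum_comp (Equiv.funSplitAt a P).symm G).symm
  have h : ∀ (p : P) (g : {j // j ≠ a} → P) (σ : P),
      Function.update ((Equiv.funSplitAt a P).symm (p, g)) a σ =
        (Equiv.funSplitAt a P).symm (σ, g) := by
    intro p g σ
    ext j
    by_cases hj : j = a
    · subst hj; simp [Equiv.funSplitAt, Equiv.piSplitAt]
    · simp [Equiv.funSplitAt, Equiv.piSplitAt, hj]
  rw [e, e F, Fintype.sum_prod_type, Fintype.sum_prod_type]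
  simp_rw [h]
  rw [Finset.sum_const, Finset.card_univ, nsmul_eq_mul, Finset.sum_comm]

/-- The points covered by the index sets `A a`, `a ∈ T`, placed by the permutations `π a`
in the columns `c a`. -/
def placed {κ W Y : Type*} [DecidableEq W] [DecidableEq Y] (c : κ → W) (A : κ → Finset Y)
    (T : Finset κ) (π : κ → Equiv.Perm Y) : Finset (W × Y) :=
  T.biUnion fun a => (A a).image fun j => (c a, π a j)

theorem card_column_placed_le {κ W Y : Type*} [DecidableEq W] [DecidableEq Y] [Fintype Y]
    (c : κ → W) (A : κ → Finset Y) (T : Finset κ) (π : κ → Equiv.Perm Y) (k : W) :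
    #{y | (k, y) ∈ placed c A T π} ≤ ∑ a ∈ T with c a = k, #(A a) := by
  classical
  refine le_trans (Finset.card_le_card (t := {a ∈ T | c a = k}.biUnion
    fun a => (A a).image (π a)) ?_) (Finset.card_biUnion_le.trans
      (Finset.sum_le_sum fun a _ => Finset.card_image_le))
  intro y hy
  simp only [placed, Finset.mem_filter, Finset.mem_univ, true_and, Finset.mem_biUnion,
    Finset.mem_image, Prod.mk.injEq] at hy ⊢
  obtain ⟨a, ha, j, hj, h1, h2⟩ := hy
  exact ⟨a, ⟨ha, h1⟩, j, hj, h2⟩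

theorem sum_pow_loss_le {κ W Y : Type*} [Fintype κ] [DecidableEq κ] [DecidableEq W]
    [DecidableEq Y] [Fintype Y] [Nonempty Y] (c : κ → W) (A : κ → Finset Y) (s : ℕ)
    (hs : ∀ k, ∑ a with c a = k, #(A a) ≤ s) {y : ℝ} (hy : 0 ≤ y) (T : Finset κ) :
    ∑ π : κ → Equiv.Perm Y, (1 + y) ^ (∑ a ∈ T, #(A a)) / (1 + y) ^ #(placed c A T π) ≤
      Fintype.card (κ → Equiv.Perm Y) *
        (1 + y * s / Fintype.card Y) ^ (∑ a ∈ T, #(A a)) := by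
  have hY : (0 : ℝ) < Fintype.card Y := by exact_mod_cast Fintype.card_pos
  have hP : (0 : ℝ) < Fintype.card (Equiv.Perm Y) := by exact_mod_cast Fintype.card_pos
  induction T using Finset.induction_on with
  | empty => simp [placed]
  | insert a T ha ih =>
    rw [Finset.sum_insert ha]
    set m := ∑ a ∈ T, #(A a) with hm
    have hplaced : ∀ π σ, placed c A T (Function.update π a σ) = placed c A T π := by
      intro π σ
      refine Finset.biUnion_congr rfl fun b hb => ?_
      rw [Function.update_of_ne (by rintro rfl; exact ha hb)]
    have hstep : ∀ (π : κ → Equiv.Perm Y) (σ : Equiv.Perm Y),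
        (1 + y) ^ (#(A a) + m) / (1 + y) ^ #(placed c A (insert a T) (Function.update π a σ)) =
        (1 + y) ^ m / (1 + y) ^ #(placed c A T π) *
          (1 + y) ^ #{j ∈ A a | σ j ∈ ({z | (c a, z) ∈ placed c A T π} : Finset Y)} := by
      intro π σ
      have hins : placed c A (insert a T) (Function.update π a σ) =
          ((A a).image fun j => (c a, σ j)) ∪ placed c A T π := by
        rw [← hplaced π σ]
        simp [placed]
      have hinj : Function.Injective fun j => (c a, σ j) := by
        intro i j h
        simpa using h
      have hcard := Finset.card_union_add_card_inter ((A a).image fun j => (c a, σ j))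
        (placed c A T π)
      rw [← hins, Finset.card_image_of_injective _ hinj] at hcard
      have hcap : #(((A a).image fun j => (c a, σ j)) ∩ placed c A T π) =
          #{j ∈ A a | σ j ∈ ({z | (c a, z) ∈ placed c A T π} : Finset Y)} := by
        rw [← Finset.card_image_of_injective _ hinj]
        congr 1
        ext p
        simp only [Finset.mem_inter, Finset.mem_image, Finset.mem_filter, Finset.mem_univ,
          true_and]
        constructor
        · rintro ⟨⟨j, hj, rfl⟩, h⟩; exact ⟨j, ⟨hj, h⟩, rfl⟩
        · rintro ⟨j, ⟨hj, h⟩, rfl⟩; exact ⟨⟨j, hj, rfl⟩, h⟩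
      rw [hcap] at hcard
      rw [div_mul_eq_mul_div, div_eq_div_iff (by positivity) (by positivity), ← pow_add,
        ← pow_add, ← pow_add]
      congr 1
      omega
    have key := sum_pi_update (fun π : κ → Equiv.Perm Y =>
      (1 + y) ^ (#(A a) + m) / (1 + y) ^ #(placed c A (insert a T) π)) a
    simp_rw [hstep, ← Finset.mul_sum] at key
    refine le_of_mul_le_mul_left ?_ hP
    rw [← key]
    calc _ ≤ ∑ π : κ → Equiv.Perm Y, (1 + y) ^ m / (1 + y) ^ #(placed c A T π) *
          (Fintype.card (Equiv.Perm Y) * (1 + y * s / Fintype.card Y) ^ #(A a)) := by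
          refine Finset.sum_le_sum fun π _ => ?_
          refine mul_le_mul_of_nonneg_left ?_ (by positivity)
          refine (sum_perm_pow_card_le _ _ hy).trans ?_
          gcongr
          exact_mod_cast (card_column_placed_le c A T π (c a)).trans
            ((Finset.sum_le_sum_of_subset (Finset.filter_subset_filter _
              (Finset.subset_univ T))).trans (hs (c a)))
      _ = (∑ π : κ → Equiv.Perm Y, (1 + y) ^ m / (1 + y) ^ #(placed c A T π)) *
          (Fintype.card (Equiv.Perm Y) * (1 + y * s / Fintype.card Y) ^ #(A a)) := by
          rw [Finset.sum_mul]
      _ ≤ (Fintype.card (κ → Equiv.Perm Y) * (1 + y * s / Fintype.card Y) ^ m) *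
          (Fintype.card (Equiv.Perm Y) * (1 + y * s / Fintype.card Y) ^ #(A a)) := by
          gcongr
      _ = _ := by rw [pow_add]; ring

/-- The transversal `{(k, π (i, k) j) : k}` indexed by `(i, j)`. -/
def transversal {u v w : ℕ} (π : Fin u × Fin w → Equiv.Perm (Fin v)) (b : Fin u × Fin v) :
    Finset (Fin w × Fin v) :=
  Finset.univ.image fun k => (k, π (b.1, k) b.2)

theorem exists_expanding_transversals (u v w N C : ℕ) (hv : 0 < v) {y : ℝ} (hy : 0 ≤ y)
    (hyN : y * N * w ≤ v) (hC : 2 * Real.exp 1 * (u * v) ≤ (1 + y) ^ C) :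
    ∃ π : Fin u × Fin w → Equiv.Perm (Fin v), ∀ J : Finset (Fin u × Fin v), #J ≤ N →
      w * #J ≤ #(J.biUnion (transversal π)) + C * #J := by
  classical
  by_contra! hcon
  have : Nonempty (Fin v) := ⟨⟨0, hv⟩⟩
  have hvR : (0 : ℝ) < v := by exact_mod_cast hv
  set Ω := Fin u × Fin w → Equiv.Perm (Fin v)
  have hΩ : (0 : ℝ) < Fintype.card Ω := by exact_mod_cast Fintype.card_pos
  set z := 1 + y with hz
  have hz1 : 1 ≤ z := by linarith
  have hz0 : 0 < z := by linarith
  set β := Real.exp 1 / z ^ C with hβ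
  have hβ0 : 0 < β := by positivity
  let good : Finset (Finset (Fin u × Fin v)) := {J | #J ≤ N ∧ J.Nonempty}
  have hlow : ∀ π : Ω, (1 : ℝ) ≤ ∑ J ∈ good,
      z ^ (w * #J) / z ^ #(J.biUnion (transversal π)) / z ^ (C * #J) := by
    intro π
    obtain ⟨J, hJN, hJ⟩ := hcon π
    have hne : J.Nonempty := by
      rw [Finset.nonempty_iff_ne_empty]; rintro rfl; simp at hJ
    refine le_trans ?_ (Finset.single_le_sum (f := fun J : Finset (Fin u × Fin v) =>
      z ^ (w * #J) / z ^ #(J.biUnion (transversal π)) / z ^ (C * #J))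
      (fun J _ => by positivity) (show J ∈ good by simp [good, hJN, hne]))
    show 1 ≤ z ^ (w * #J) / z ^ #(J.biUnion (transversal π)) / z ^ (C * #J)
    rw [div_div, ← pow_add, one_le_div (by positivity)]
    exact pow_le_pow_right₀ hz1 hJ.le
  have hup : ∀ J ∈ good, ∑ π : Ω, z ^ (w * #J) / z ^ #(J.biUnion (transversal π)) ≤
      Fintype.card Ω * Real.exp 1 ^ #J := by
    intro J hJ
    have hJN : #J ≤ N := by simp only [good, Finset.mem_filter] at hJ; exact hJ.2.1
    set A : Fin u × Fin w → Finset (Fin v) := fun a => {j | (a.1, j) ∈ J} with hA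
    have hfib : ∑ i, #({j | (i, j) ∈ J} : Finset (Fin v)) = #J := by
      have := Finset.card_eq_sum_card_fiberwise (f := Prod.fst) (s := J)
        (t := Finset.univ) (fun _ _ => by simp)
      rw [this]
      refine Finset.sum_congr rfl fun i _ => ?_
      rw [← Finset.card_image_of_injective (f := fun j => (i, j)) _
        (fun _ _ h => by simpa using h)]
      congr 1
      ext ⟨i', j⟩
      simp only [Finset.mem_image, Finset.mem_filter, Finset.mem_univ, true_and, Prod.mk.injEq]
      constructor
      · rintro ⟨j', h, rfl, rfl⟩; exact ⟨h, rfl⟩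
      · rintro ⟨h, rfl⟩; exact ⟨j, h, rfl, rfl⟩
    have hcol : ∀ k : Fin w, ∑ a : Fin u × Fin w with a.2 = k, #(A a) = #J := by
      intro k
      rw [Finset.sum_filter, Fintype.sum_prod_type]
      simpa [hA] using hfib
    have htot : ∑ a : Fin u × Fin w, #(A a) = w * #J := by
      rw [Fintype.sum_prod_type]
      simp only [hA, Finset.sum_const, Finset.card_univ, Fintype.card_fin, smul_eq_mul]
      rw [← Finset.mul_sum, hfib]
    have hpl : ∀ π : Ω, placed Prod.snd A Finset.univ π = J.biUnion (transversal π) := by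
      intro π
      ext ⟨k, x⟩
      simp only [placed, transversal, hA, Finset.mem_biUnion, Finset.mem_image,
        Finset.mem_filter, Finset.mem_univ, true_and, Prod.mk.injEq, Prod.exists]
      constructor
      · rintro ⟨i, k', j, hj, rfl, rfl⟩; exact ⟨i, j, hj, k', rfl, rfl⟩
      · rintro ⟨i, j, hj, k', rfl, rfl⟩; exact ⟨i, k', j, hj, rfl, rfl⟩
    have := sum_pow_loss_le Prod.snd A #J (fun k => (hcol k).le) hy Finset.univ
    simp_rw [hpl, htot] at this
    refine this.trans ?_
    rw [Fintype.card_fin, pow_mul]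
    gcongr
    calc (1 + y * #J / v) ^ w ≤ Real.exp (y * #J / v) ^ w := by
          gcongr
          rw [add_comm]; exact Real.add_one_le_exp _
      _ = Real.exp (w * (y * #J / v)) := by rw [← Real.exp_nat_mul]
      _ ≤ Real.exp 1 := by
          gcongr
          rw [mul_div_assoc', div_le_one hvR]
          have : (#J : ℝ) ≤ N := by exact_mod_cast hJN
          calc (w : ℝ) * (y * #J) ≤ w * (y * N) := by gcongr
            _ ≤ v := by linarith
  have h1 : (Fintype.card Ω : ℝ) ≤ Fintype.card Ω * ∑ J ∈ good, β ^ #J := by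
    calc (Fintype.card Ω : ℝ) = ∑ _π : Ω, (1 : ℝ) := by simp
      _ ≤ ∑ π : Ω, ∑ J ∈ good,
          z ^ (w * #J) / z ^ #(J.biUnion (transversal π)) / z ^ (C * #J) :=
          Finset.sum_le_sum fun π _ => hlow π
      _ = ∑ J ∈ good, (∑ π : Ω, z ^ (w * #J) / z ^ #(J.biUnion (transversal π))) /
          z ^ (C * #J) := by
          rw [Finset.sum_comm]; simp_rw [Finset.sum_div]
      _ ≤ ∑ J ∈ good, Fintype.card Ω * β ^ #J := by
          refine Finset.sum_le_sum fun J hJ => ?_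
          rw [hβ, div_pow, ← pow_mul, mul_div_assoc']
          gcongr
          exact hup J hJ
      _ = _ := by rw [Finset.mul_sum]
  have h2 : ∑ J ∈ good, β ^ #J + 1 ≤ (β + 1) ^ (u * v) := by
    have h3 : (β + 1) ^ (u * v) = ∑ J : Finset (Fin u × Fin v), β ^ #J := by
      have := Finset.sum_pow_mul_eq_add_pow β 1 (Finset.univ : Finset (Fin u × Fin v))
      simpa using this.symm
    rw [h3, ← Finset.sum_add_sum_compl good]
    gcongr
    refine le_trans ?_ (Finset.single_le_sum (f := fun J : Finset (Fin u × Fin v) => β ^ #J)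
      (fun J _ => by positivity) (show ∅ ∈ goodᶜ by simp [good]))
    simp
  have h4 : (β + 1) ^ (u * v) < 2 := by
    calc (β + 1) ^ (u * v) ≤ Real.exp β ^ (u * v) := by
          gcongr; exact Real.add_one_le_exp _
      _ = Real.exp ((u * v : ℕ) * β) := by rw [← Real.exp_nat_mul]
      _ ≤ Real.exp (1 / 2) := by
          gcongr
          rw [hβ, mul_div_assoc', div_le_div_iff₀ (by positivity) (by norm_num)]
          push_cast
          linarith
      _ < 2 := by
          have h5 : Real.exp (1 / 2) ^ 2 = Real.exp 1 := by
            rw [← Real.exp_nat_mul]; norm_num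
          nlinarith [Real.exp_one_lt_d9, Real.exp_pos (1 / 2)]
  have h6 : 1 ≤ ∑ J ∈ good, β ^ #J := by
    by_contra! h
    nlinarith
  linarith

section Probability

variable {α : Type*} [Fintype α] {D : α → ℝ}

theorem dPr_congr {E F : α → Prop} (h : ∀ x, E x ↔ F x) : dPr D E = dPr D F := by
  congr 1
  exact funext fun x => propext (h x)

theorem dPr_nonneg (hD : ∀ x, 0 ≤ D x) (E : α → Prop) : 0 ≤ dPr D E :=
  Finset.sum_nonneg fun x _ => by split_ifs <;> simp [hD x]

theorem dPr_mono (hD : ∀ x, 0 ≤ D x) {E F : α → Prop} (h : ∀ x, E x → F x) :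
    dPr D E ≤ dPr D F := by
  refine Finset.sum_le_sum fun x _ => ?_
  by_cases hE : E x
  · simp [hE, h x hE]
  · rw [if_neg hE]; split_ifs <;> simp [hD x]

theorem dPr_and_add_and_not (E A : α → Prop) :
    dPr D (fun x => E x ∧ A x) + dPr D (fun x => E x ∧ ¬A x) = dPr D E := by
  unfold dPr
  rw [← Finset.sum_add_distrib]
  refine Finset.sum_congr rfl fun x _ => ?_
  by_cases hE : E x <;> by_cases hA : A x <;> simp [hE, hA]

theorem dPr_exists_le {β : Type*} (hD : ∀ x, 0 ≤ D x) (s : Finset β) (E : β → α → Prop) :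
    dPr D (fun x => ∃ b ∈ s, E b x) ≤ ∑ b ∈ s, dPr D (E b) := by
  classical
  unfold dPr
  rw [Finset.sum_comm]
  refine Finset.sum_le_sum fun x _ => ?_
  have h0 : ∀ b ∈ s, 0 ≤ (if E b x then D x else 0) := fun b _ => by
    split_ifs <;> simp [hD x]
  split_ifs with h
  · obtain ⟨b, hb, hE⟩ := h
    have h1 := Finset.single_le_sum h0 hb
    rw [if_pos hE] at h1
    convert h1
  · convert Finset.sum_nonneg h0

end Probability

/-- Truncated alternating binomial sums approximate `(1 - x) ^ N`. -/
theorem abs_alternating_choose_sub_le {x : ℝ} (hx0 : 0 ≤ x) (hx1 : x ≤ 1) (N s : ℕ) :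
    |∑ m ∈ Finset.range (s + 1), (-1) ^ m * ((N.choose m : ℝ) * x ^ m) - (1 - x) ^ N| ≤
      N.choose (s + 1) * x ^ (s + 1) := by
  induction N generalizing s with
  | zero =>
    rw [Finset.sum_range_succ']
    simp
  | succ N ih =>
    cases s with
    | zero =>
      have h1 : (1 - x) ^ (N + 1) ≤ 1 := pow_le_one₀ (by linarith) (by linarith)
      have h2 := one_add_mul_le_pow (a := -x) (by linarith) (N + 1)
      have h3 : (1 + -x) ^ (N + 1) = (1 - x) ^ (N + 1) := by ring
      rw [abs_of_nonneg] <;> simp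
      · rw [h3] at h2; push_cast at h2; linarith
      · exact h1
    | succ s =>
      have h1 : ∑ m ∈ Finset.range (s + 1 + 1), (-1) ^ m * (((N + 1).choose m : ℝ) * x ^ m) =
          ∑ m ∈ Finset.range (s + 1 + 1), (-1) ^ m * ((N.choose m : ℝ) * x ^ m) -
          x * ∑ m ∈ Finset.range (s + 1), (-1) ^ m * ((N.choose m : ℝ) * x ^ m) := by
        rw [Finset.sum_range_succ', Finset.sum_range_succ' _ (s + 1), Finset.mul_sum,
          add_sub_right_comm, ← Finset.sum_sub_distrib]
        simp only [Nat.choose_zero_right]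
        congr 1
        refine Finset.sum_congr rfl fun m _ => ?_
        rw [Nat.choose_succ_succ]
        push_cast
        ring
      have h2 := ih (s + 1)
      have h3 := ih s
      rw [h1, Nat.choose_succ_succ]
      set P := ∑ m ∈ Finset.range (s + 1 + 1), (-1) ^ m * ((N.choose m : ℝ) * x ^ m)
      set P' := ∑ m ∈ Finset.range (s + 1), (-1) ^ m * ((N.choose m : ℝ) * x ^ m)
      calc |P - x * P' - (1 - x) ^ (N + 1)|
          = |(P - (1 - x) ^ N) + -(x * (P' - (1 - x) ^ N))| := by congr 1; ring
        _ ≤ |P - (1 - x) ^ N| + |x * (P' - (1 - x) ^ N)| := by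
            simpa using abs_add_le (P - (1 - x) ^ N) (-(x * (P' - (1 - x) ^ N)))
        _ = |P - (1 - x) ^ N| + x * |P' - (1 - x) ^ N| := by
            rw [abs_mul, abs_of_nonneg hx0]
        _ ≤ N.choose (s + 1 + 1) * x ^ (s + 1 + 1) + x * (N.choose (s + 1) * x ^ (s + 1)) := by
            gcongr
        _ = _ := by simp only [Nat.succ_eq_add_one]; push_cast; ring

theorem abs_bonferroni_sub_le {α β : Type*} [Fintype α] {D : α → ℝ} (hD : ∀ x, 0 ≤ D x)
    (E : α → Prop) (P : β → α → Prop) (𝓑 : Finset β) (s : ℕ) :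
    |dPr D (fun x => E x ∧ ∀ b ∈ 𝓑, ¬P b x) -
      ∑ m ∈ Finset.range (s + 1), (-1) ^ m *
        ∑ J ∈ 𝓑.powersetCard m, dPr D (fun x => E x ∧ ∀ b ∈ J, P b x)| ≤
      ∑ J ∈ 𝓑.powersetCard (s + 1), dPr D (fun x => E x ∧ ∀ b ∈ J, P b x) := by
  classical
  set Y : α → ℕ := fun x => #{b ∈ 𝓑 | P b x} with hY
  set e : α → ℝ := fun x => if E x then D x else 0 with he
  have he0 : ∀ x, 0 ≤ e x := fun x => by simp only [he]; split_ifs <;> simp [hD x]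
  have hmom : ∀ m, ∑ J ∈ 𝓑.powersetCard m, dPr D (fun x => E x ∧ ∀ b ∈ J, P b x) =
      ∑ x, e x * ((Y x).choose m : ℝ) := by
    intro m
    unfold dPr
    rw [Finset.sum_comm]
    refine Finset.sum_congr rfl fun x _ => ?_
    have : ((Y x).choose m : ℝ) = ∑ J ∈ 𝓑.powersetCard m, if ∀ b ∈ J, P b x then 1 else 0 := by
      rw [hY, ← Finset.card_powersetCard, ← Finset.sum_filter, Finset.sum_const, nsmul_one]
      congr 2
      ext J
      simp only [Finset.mem_powersetCard, Finset.mem_filter, Finset.subset_iff]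
      exact ⟨fun h => ⟨⟨fun _ hx => (h.1 hx).1, h.2⟩, fun _ hx => (h.1 hx).2⟩,
        fun h => ⟨fun x hx => ⟨h.1.1 hx, h.2 x hx⟩, h.1.2⟩⟩
    rw [this, Finset.mul_sum]
    refine Finset.sum_congr rfl fun J _ => ?_
    simp only [he]
    by_cases h1 : E x <;> by_cases h2 : ∀ b ∈ J, P b x <;> simp [h1, h2]
  have hzero : dPr D (fun x => E x ∧ ∀ b ∈ 𝓑, ¬P b x) = ∑ x, e x * (1 - 1 : ℝ) ^ (Y x) := by
    unfold dPr
    refine Finset.sum_congr rfl fun x _ => ?_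
    simp only [he, sub_self, zero_pow_eq, hY, Finset.card_eq_zero, Finset.filter_eq_empty_iff]
    by_cases h1 : E x <;> by_cases h2 : ∀ b ∈ 𝓑, ¬P b x <;> simp [h1, h2]
  simp_rw [hmom]
  rw [hzero, abs_sub_comm]
  simp_rw [Finset.mul_sum]
  rw [Finset.sum_comm, ← Finset.sum_sub_distrib]
  refine (Finset.abs_sum_le_sum_abs _ _).trans (Finset.sum_le_sum fun x _ => ?_)
  have h := abs_alternating_choose_sub_le zero_le_one le_rfl (Y x) s
  simp only [one_pow, mul_one] at h
  calc |∑ m ∈ Finset.range (s + 1), (-1) ^ m * (e x * ((Y x).choose m : ℝ)) -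
        e x * (1 - 1) ^ Y x|
      = |e x * (∑ m ∈ Finset.range (s + 1), (-1) ^ m * ((Y x).choose m : ℝ) -
          (1 - 1) ^ Y x)| := by
        rw [mul_sub, Finset.mul_sum]
        congr 2
        exact Finset.sum_congr rfl fun m _ => by ring
    _ = e x * |∑ m ∈ Finset.range (s + 1), (-1) ^ m * ((Y x).choose m : ℝ) -
          (1 - 1) ^ Y x| := by rw [abs_mul, abs_of_nonneg (he0 x)]
    _ ≤ _ := by gcongr; exact he0 x

section Moments

variable {ι : Type*} [Fintype ι] [DecidableEq ι] {D : (ι → Bool) → ℝ} {t : ℕ}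

theorem dPr_forall_eq_true (hD : kWiseIndep D t) (V : Finset ι) (hV : #V ≤ t) :
    dPr D (fun x => ∀ k ∈ V, x k = true) = (1 / 2) ^ #V := by
  rw [← hD V hV fun _ => true]
  unfold dPr
  congr!

theorem abs_planted_avoid_sub_le {β : Type*} (hD0 : ∀ x, 0 ≤ D x)
    (hD : kWiseIndep D t) (V : Finset ι) (B : β → Finset ι) (𝓑 : Finset β) (s : ℕ)
    (ht : ∀ J ⊆ 𝓑, #J ≤ s + 1 → #(V ∪ J.biUnion B) ≤ t) :
    |dPr D (fun x => (∀ k ∈ V, x k = true) ∧ ∀ b ∈ 𝓑, ¬∀ k ∈ B b, x k = true) -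
      ∑ m ∈ Finset.range (s + 1), (-1) ^ m *
        ∑ J ∈ 𝓑.powersetCard m, (1 / 2 : ℝ) ^ #(V ∪ J.biUnion B)| ≤
      ∑ J ∈ 𝓑.powersetCard (s + 1), (1 / 2 : ℝ) ^ #(V ∪ J.biUnion B) := by
  have h := abs_bonferroni_sub_le hD0 (fun x => ∀ k ∈ V, x k = true)
    (fun b x => ∀ k ∈ B b, x k = true) 𝓑 s
  have hJ : ∀ m ≤ s + 1, ∀ J ∈ 𝓑.powersetCard m,
      dPr D (fun x => (∀ k ∈ V, x k = true) ∧ ∀ b ∈ J, ∀ k ∈ B b, x k = true) =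
        (1 / 2 : ℝ) ^ #(V ∪ J.biUnion B) := by
    intro m hm J hJ
    rw [Finset.mem_powersetCard] at hJ
    rw [← dPr_forall_eq_true hD _ (ht J hJ.1 (hJ.2 ▸ hm))]
    refine dPr_congr fun x => ?_
    simp only [Finset.mem_union, Finset.mem_biUnion]
    constructor
    · rintro ⟨h1, h2⟩ k (hk | ⟨b, hb, hk⟩)
      · exact h1 k hk
      · exact h2 b hb k hk
    · intro h
      exact ⟨fun k hk => h k (Or.inl hk), fun b hb k hk => h k (Or.inr ⟨b, hb, hk⟩)⟩
  rw [Finset.sum_congr rfl (hJ (s + 1) le_rfl)] at h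
  rwa [Finset.sum_congr rfl fun m hm => by
    rw [Finset.sum_congr rfl (hJ m (Finset.mem_range.1 hm).le)]] at h

/-- Avoiding pairwise disjoint blocks that are also disjoint from a planted set. -/
theorem abs_planted_avoid_disjoint_sub_le {β : Type*} (hD0 : ∀ x, 0 ≤ D x)
    (hD : kWiseIndep D t) (V : Finset ι) (B : β → Finset ι) (𝓑 : Finset β) (s w : ℕ)
    (hB : ∀ b ∈ 𝓑, #(B b) = w) (hBV : ∀ b ∈ 𝓑, Disjoint V (B b))
    (hdisj : (𝓑 : Set β).PairwiseDisjoint B) (ht : #V + (s + 1) * w ≤ t) :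
    |dPr D (fun x => (∀ k ∈ V, x k = true) ∧ ∀ b ∈ 𝓑, ¬∀ k ∈ B b, x k = true) -
      (1 / 2) ^ #V * (1 - (1 / 2) ^ w) ^ #𝓑| ≤
      2 * ((1 / 2) ^ #V * ((#𝓑).choose (s + 1) * ((1 / 2) ^ w) ^ (s + 1))) := by
  have hcard : ∀ J ⊆ 𝓑, #(V ∪ J.biUnion B) = #V + #J * w := by
    intro J hJ
    rw [Finset.card_union_of_disjoint, Finset.card_biUnion, Finset.sum_const_nat]
    · exact fun b hb => hB b (hJ hb)
    · exact fun a ha b hb hab => hdisj (hJ ha) (hJ hb) hab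
    · rw [Finset.disjoint_biUnion_right]
      exact fun b hb => hBV b (hJ hb)
  have h := abs_planted_avoid_sub_le hD0 hD V B 𝓑 s (fun J hJ hJs => by
    rw [hcard J hJ]
    exact le_trans (by gcongr) ht)
  have hsum : ∀ m, ∑ J ∈ 𝓑.powersetCard m, (1 / 2 : ℝ) ^ #(V ∪ J.biUnion B) =
      (1 / 2) ^ #V * ((#𝓑).choose m * ((1 / 2) ^ w) ^ m) := by
    intro m
    rw [Finset.sum_congr rfl (g := fun _ => (1 / 2 : ℝ) ^ (#V + m * w)), Finset.sum_const,
      Finset.card_powersetCard, nsmul_eq_mul, ← pow_mul, pow_add, mul_comm m w]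
    · ring
    · intro J hJ
      rw [Finset.mem_powersetCard] at hJ
      rw [hcard J hJ.1, hJ.2]
  simp_rw [hsum] at h
  have hx1 : (1 / 2 : ℝ) ^ w ≤ 1 := pow_le_one₀ (by norm_num) (by norm_num)
  have h2 := abs_alternating_choose_sub_le (x := (1 / 2 : ℝ) ^ w) (by positivity) hx1 #𝓑 s
  have hV : (0 : ℝ) < (1 / 2) ^ #V := by positivity
  set S := ∑ m ∈ Finset.range (s + 1), (-1) ^ m * (((#𝓑).choose m : ℝ) * ((1 / 2) ^ w) ^ m)
  have h3 : ∑ m ∈ Finset.range (s + 1), (-1) ^ m * ((1 / 2 : ℝ) ^ #V *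
      (((#𝓑).choose m : ℝ) * ((1 / 2) ^ w) ^ m)) = (1 / 2) ^ #V * S := by
    rw [Finset.mul_sum]
    exact Finset.sum_congr rfl fun m _ => by ring
  rw [h3] at h
  have h4 : |(1 / 2 : ℝ) ^ #V * S - (1 / 2) ^ #V * (1 - (1 / 2) ^ w) ^ #𝓑| ≤
      (1 / 2) ^ #V * ((#𝓑).choose (s + 1) * ((1 / 2) ^ w) ^ (s + 1)) := by
    rw [← mul_sub, abs_mul, abs_of_pos hV]
    gcongr
  refine (abs_sub_le _ ((1 / 2 : ℝ) ^ #V * S) _).trans ?_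
  linarith

end Moments

/-- The uniform distribution on `ι → Bool`. -/
noncomputable def unif (ι : Type*) [Fintype ι] : (ι → Bool) → ℝ :=
  fun _ => (1 / 2) ^ Fintype.card ι

theorem unif_nonneg {ι : Type*} [Fintype ι] (x : ι → Bool) : 0 ≤ unif ι x := by
  unfold unif; positivity

theorem monotone_forall_eq_true {ι : Type*} (V : Finset ι) :
    Monotone fun x : ι → Bool => ∀ k ∈ V, x k = true := by
  intro x y hxy h k hk
  have h1 := hxy k
  rw [h k hk] at h1
  exact top_le_iff.1 h1

theorem antitone_avoid {ι β : Type*} (B : β → Finset ι) (𝓑 : Finset β) :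
    Antitone fun x : ι → Bool => ∀ b ∈ 𝓑, ¬∀ k ∈ B b, x k = true :=
  fun _ _ hxy h b hb h' => h b hb (monotone_forall_eq_true (B b) hxy h')

section Uniform

variable {ι : Type*} [Fintype ι] [DecidableEq ι]

theorem sum_unif : ∑ x, unif ι x = 1 := by
  simp [unif, Finset.card_univ]

theorem dPr_unif_true : dPr (unif ι) (fun _ => True) = 1 := by
  rw [← sum_unif (ι := ι)]
  simp [dPr]

theorem kWiseIndep_unif (t : ℕ) : kWiseIndep (unif ι) t := by
  intro I _ σ
  have hcount : #{x : ι → Bool | ∀ i ∈ I, x i = σ i} = 2 ^ (Fintype.card ι - #I) := by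
    have h1 : ({x : ι → Bool | ∀ i ∈ I, x i = σ i} : Finset (ι → Bool)) =
        Fintype.piFinset fun i => if i ∈ I then {σ i} else Finset.univ := by
      ext x
      simp only [Finset.mem_filter, Finset.mem_univ, true_and, Fintype.mem_piFinset]
      refine forall_congr' fun i => ?_
      by_cases hi : i ∈ I <;> simp [hi]
    rw [h1, Fintype.card_piFinset]
    have h2 : ∀ i, #(if i ∈ I then {σ i} else (Finset.univ : Finset Bool)) =
        if i ∈ Iᶜ then 2 else 1 := by
      intro i
      by_cases hi : i ∈ I <;> simp [hi]
    simp_rw [h2]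
    rw [Finset.prod_ite_mem, Finset.univ_inter, Finset.prod_const, Finset.card_compl]
  have h3 : ∑ x : ι → Bool, (if ∀ i ∈ I, x i = σ i then unif ι x else 0) =
      (1 / 2 : ℝ) ^ #I := by
    rw [← Finset.sum_filter]
    simp only [unif]
    rw [Finset.sum_const, hcount, nsmul_eq_mul]
    have hle : #I ≤ Fintype.card ι := Finset.card_le_univ I
    obtain ⟨d, hd⟩ := Nat.exists_eq_add_of_le hle
    rw [hd, Nat.add_sub_cancel_left, pow_add]
    push_cast
    rw [mul_left_comm, ← mul_pow]
    norm_num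
  rw [← h3]
  congr!

theorem mul_sum_le_sum_mul_of_monotone {f g : (ι → Bool) → ℝ} (hf0 : ∀ x, 0 ≤ f x)
    (hg0 : ∀ x, 0 ≤ g x) (hf : Monotone f) (hg : Monotone g) :
    (∑ x, unif ι x * f x) * ∑ x, unif ι x * g x ≤ ∑ x, unif ι x * (f x * g x) := by
  have h := fkg (μ := unif ι) (f := f) (g := g) (fun x => unif_nonneg x) hf0 hg0 hf hg
    (fun _ _ => le_rfl)
  rwa [sum_unif, one_mul] at h

/-- The Harris inequality for two increasing events. -/
theorem dPr_unif_mul_le_of_monotone {A B : (ι → Bool) → Prop} (hA : Monotone A)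
    (hB : Monotone B) :
    dPr (unif ι) A * dPr (unif ι) B ≤ dPr (unif ι) (fun x => A x ∧ B x) := by
  classical
  have hmono : ∀ {A : (ι → Bool) → Prop}, Monotone A →
      Monotone fun x => if A x then (1 : ℝ) else 0 := by
    intro A hA x y hxy
    by_cases h : A x
    · simp [h, hA hxy h]
    · simp only [h, if_false]; split_ifs <;> norm_num
  have h := mul_sum_le_sum_mul_of_monotone
    (fun x => by split_ifs <;> norm_num) (fun x => by split_ifs <;> norm_num)
    (hmono hA) (hmono hB)
  unfold dPr
  refine le_of_eq_of_le ?_ (h.trans_eq ?_)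
  · simp
  · refine Finset.sum_congr rfl fun x _ => ?_
    by_cases h1 : A x <;> by_cases h2 : B x <;> simp [h1, h2]

theorem dPr_unif_not (A : (ι → Bool) → Prop) :
    dPr (unif ι) (fun x => ¬A x) = 1 - dPr (unif ι) A := by
  have h := dPr_and_add_and_not (D := unif ι) (fun _ => True) A
  simp only [true_and] at h
  rw [dPr_unif_true] at h
  linarith

/-- The Harris inequality for a decreasing and an increasing event. -/
theorem dPr_unif_and_le_of_antitone {G A : (ι → Bool) → Prop} (hG : Antitone G)
    (hA : Monotone A) :
    dPr (unif ι) (fun x => G x ∧ A x) ≤ dPr (unif ι) G * dPr (unif ι) A := by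
  have hG' : Monotone fun x => ¬G x := fun x y hxy h h' => h (hG hxy h')
  have h1 := dPr_unif_mul_le_of_monotone hA hG'
  have h2 := dPr_and_add_and_not (D := unif ι) A G
  rw [dPr_unif_not] at h1
  rw [dPr_congr (F := fun x => A x ∧ G x) fun x => and_comm]
  linarith

/-- The Harris inequality for two decreasing events. -/
theorem dPr_unif_mul_le_of_antitone {G H : (ι → Bool) → Prop} (hG : Antitone G)
    (hH : Antitone H) :
    dPr (unif ι) G * dPr (unif ι) H ≤ dPr (unif ι) (fun x => G x ∧ H x) := by
  have hH' : Monotone fun x => ¬H x := fun x y hxy h h' => h (hH hxy h')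
  have h1 := dPr_unif_and_le_of_antitone hG hH'
  have h2 := dPr_and_add_and_not (D := unif ι) G H
  rw [dPr_unif_not] at h1
  linarith

theorem dPr_unif_forall_eq_true (V : Finset ι) :
    dPr (unif ι) (fun x => ∀ k ∈ V, x k = true) = (1 / 2) ^ #V :=
  dPr_forall_eq_true (kWiseIndep_unif #V) V le_rfl

/-- An event not depending on the coordinates in `V` is independent of `x` being `1` on `V`. -/
theorem dPr_unif_and_forall_eq_true (G : (ι → Bool) → Prop) (V : Finset ι)
    (hG : ∀ x y : ι → Bool, (∀ i ∉ V, x i = y i) → (G x ↔ G y)) :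
    dPr (unif ι) (fun x => G x ∧ ∀ k ∈ V, x k = true) = (1 / 2) ^ #V * dPr (unif ι) G := by
  induction V using Finset.induction_on with
  | empty => simp
  | insert a V ha ih =>
    have ih' := ih fun x y h => hG x y fun i hi => h i fun hiV =>
      hi (Finset.mem_insert_of_mem hiV)
    set H : (ι → Bool) → Prop := fun x => G x ∧ ∀ k ∈ V, x k = true with hH
    have hflip : dPr (unif ι) (fun x => H x ∧ ¬x a = true) =
        dPr (unif ι) (fun x => H x ∧ x a = true) := by
      let f : (ι → Bool) → (ι → Bool) := fun x => Function.update x a (!x a)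
      have hf : Function.Involutive f := by
        intro x
        simp [f]
      have hHf : ∀ x, H (f x) ↔ H x := by
        intro x
        refine and_congr (hG _ _ fun i hi => ?_) (forall₂_congr fun k hk => ?_)
        · rw [Finset.mem_insert, not_or] at hi
          simp [f, hi.1]
        · have : k ≠ a := by rintro rfl; exact ha hk
          simp [f, this]
      unfold dPr
      rw [← Equiv.sum_comp (hf.toPerm f)]
      refine Finset.sum_congr rfl fun x _ => ?_
      have this : (H (hf.toPerm f x) ∧ ¬hf.toPerm f x a = true) ↔ (H x ∧ x a = true) := by
        rw [Function.Involutive.coe_toPerm, hHf]; simp [f]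
      by_cases h : H x ∧ x a = true
      · exact (if_pos (this.2 h)).trans (if_pos h).symm
      · exact (if_neg (mt this.1 h)).trans (if_neg h).symm
    have hadd := dPr_and_add_and_not (D := unif ι) H (fun x => x a = true)
    rw [hflip, ih'] at hadd
    rw [Finset.card_insert_of_notMem ha,
      dPr_congr (F := fun x => H x ∧ x a = true) fun x => by
        simp only [hH, Finset.forall_mem_insert]; tauto]
    rw [pow_succ]
    linarith

theorem prod_le_dPr_unif_avoid {β : Type*} (B : β → Finset ι) (𝓑 : Finset β) :
    ∏ b ∈ 𝓑, (1 - (1 / 2 : ℝ) ^ #(B b)) ≤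
      dPr (unif ι) (fun x => ∀ b ∈ 𝓑, ¬∀ k ∈ B b, x k = true) := by
  classical
  induction 𝓑 using Finset.induction_on with
  | empty => simp [dPr_unif_true]
  | insert a 𝓑 ha ih =>
    rw [Finset.prod_insert ha]
    have hle : (1 / 2 : ℝ) ^ #(B a) ≤ 1 := pow_le_one₀ (by norm_num) (by norm_num)
    have hant : Antitone fun x : ι → Bool => ¬∀ k ∈ B a, x k = true :=
      fun x y hxy h h' => h (monotone_forall_eq_true (B a) hxy h')
    have h := dPr_unif_mul_le_of_antitone hant (antitone_avoid B 𝓑)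
    rw [dPr_unif_not, dPr_unif_forall_eq_true] at h
    refine (mul_le_mul_of_nonneg_left ih (by linarith)).trans (h.trans_eq ?_)
    exact dPr_congr fun x => by simp only [Finset.forall_mem_insert]

/-- An inequality of Janson type for avoiding a family of blocks of common size. -/
theorem dPr_unif_avoid_le {β : Type*} [DecidableEq β] (B : β → Finset ι) (w : ℕ) (Δ : ℝ)
    (hΔ : Δ ≤ (1 / 2) ^ w) (𝓑 : Finset β) (hB : ∀ b ∈ 𝓑, #(B b) = w)
    (hdep : ∀ a ∈ 𝓑, ∑ b ∈ 𝓑 with b ≠ a ∧ ¬Disjoint (B a) (B b),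
      (1 / 2 : ℝ) ^ #(B a ∪ B b) ≤ Δ) :
    dPr (unif ι) (fun x => ∀ b ∈ 𝓑, ¬∀ k ∈ B b, x k = true) ≤
      (1 - (1 / 2) ^ w + Δ) ^ #𝓑 := by
  induction 𝓑 using Finset.induction_on with
  | empty => simp [dPr_unif_true]
  | insert a 𝓑 ha ih =>
    set p : ℝ := (1 / 2) ^ w with hp
    have hp1 : p ≤ 1 := pow_le_one₀ (by norm_num) (by norm_num)
    have hBa : #(B a) = w := hB a (Finset.mem_insert_self a 𝓑)
    have hdepa := hdep a (Finset.mem_insert_self a 𝓑)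
    have hΔ0 : 0 ≤ Δ := le_trans (Finset.sum_nonneg fun b _ => by positivity) hdepa
    have ih' := ih (fun b hb => hB b (Finset.mem_insert_of_mem hb)) fun b hb =>
      le_trans (Finset.sum_le_sum_of_subset_of_nonneg
        (Finset.filter_subset_filter _ (Finset.subset_insert a 𝓑))
        fun _ _ _ => by positivity) (hdep b (Finset.mem_insert_of_mem hb))
    set E : (ι → Bool) → Prop := fun x => ∀ b ∈ 𝓑, ¬∀ k ∈ B b, x k = true with hE
    set A : (ι → Bool) → Prop := fun x => ∀ k ∈ B a, x k = true with hA
    set nb : Finset β := {b ∈ 𝓑 | ¬Disjoint (B a) (B b)} with hnb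
    set far : Finset β := {b ∈ 𝓑 | Disjoint (B a) (B b)} with hfar
    set G : (ι → Bool) → Prop := fun x => ∀ b ∈ far, ¬∀ k ∈ B b, x k = true with hG
    have hGA : dPr (unif ι) (fun x => G x ∧ A x) = p * dPr (unif ι) G := by
      rw [hp, ← hBa]
      refine dPr_unif_and_forall_eq_true G (B a) fun x y hxy => ?_
      refine forall₂_congr fun b hb => not_congr (forall₂_congr fun k hk => ?_)
      rw [hxy k fun hka => ?_]
      rw [hfar, Finset.mem_filter] at hb
      exact Finset.disjoint_left.1 hb.2 hka hk
    have hnbsum : ∑ b ∈ nb, dPr (unif ι) (fun x => G x ∧ ∀ k ∈ B a ∪ B b, x k = true) ≤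
        dPr (unif ι) G * Δ := by
      calc _ ≤ ∑ b ∈ nb, dPr (unif ι) G * (1 / 2) ^ #(B a ∪ B b) := by
            refine Finset.sum_le_sum fun b _ => ?_
            rw [← dPr_unif_forall_eq_true]
            exact dPr_unif_and_le_of_antitone (antitone_avoid B far)
              (monotone_forall_eq_true _)
        _ ≤ _ := by
            rw [← Finset.mul_sum]
            refine mul_le_mul_of_nonneg_left (le_trans ?_ hdepa) (dPr_nonneg unif_nonneg _)
            refine Finset.sum_le_sum_of_subset_of_nonneg ?_ fun _ _ _ => by positivity
            intro b hb
            rw [hnb, Finset.mem_filter] at hb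
            rw [Finset.mem_filter]
            exact ⟨Finset.mem_insert_of_mem hb.1, by rintro rfl; exact ha hb.1, hb.2⟩
    have hEA : dPr (unif ι) (fun x => G x ∧ A x) ≤ dPr (unif ι) (fun x => E x ∧ A x) +
        ∑ b ∈ nb, dPr (unif ι) (fun x => G x ∧ ∀ k ∈ B a ∪ B b, x k = true) := by
      refine le_trans ?_ (add_le_add le_rfl (dPr_exists_le unif_nonneg _ _))
      rw [← dPr_and_add_and_not (fun x => G x ∧ A x) E]
      refine add_le_add (dPr_mono unif_nonneg fun x h => ⟨h.2, h.1.2⟩)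
        (dPr_mono unif_nonneg fun x h => ?_)
      obtain ⟨⟨hGx, hAx⟩, hEx⟩ := h
      obtain ⟨b, hb, hbx⟩ : ∃ b ∈ 𝓑, ∀ k ∈ B b, x k = true := by
        by_contra h
        exact hEx fun b hb hk => h ⟨b, hb, hk⟩
      have hbnb : b ∈ nb := by
        rw [hnb, Finset.mem_filter]
        refine ⟨hb, fun hd => hGx b ?_ fun k hk => hbx k hk⟩
        rw [hfar, Finset.mem_filter]
        exact ⟨hb, hd⟩
      refine ⟨b, hbnb, hGx, fun k hk => ?_⟩
      rcases Finset.mem_union.1 hk with hk | hk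
      · exact hAx k hk
      · exact hbx k hk
    have hEG : dPr (unif ι) E ≤ dPr (unif ι) G :=
      dPr_mono unif_nonneg fun x h b hb => h b (Finset.mem_filter.1 hb).1
    have hsplit := dPr_and_add_and_not (D := unif ι) E A
    have hgoal : dPr (unif ι) (fun x => ∀ b ∈ insert a 𝓑, ¬∀ k ∈ B b, x k = true) =
        dPr (unif ι) (fun x => E x ∧ ¬A x) :=
      dPr_congr fun x => by simp only [Finset.forall_mem_insert, hE, hA]; tauto
    rw [hgoal, Finset.card_insert_of_notMem ha, pow_succ]
    have h1 : dPr (unif ι) E * (p - Δ) ≤ dPr (unif ι) G * (p - Δ) :=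
      mul_le_mul_of_nonneg_right hEG (by linarith)
    calc dPr (unif ι) (fun x => E x ∧ ¬A x) ≤ dPr (unif ι) E * (1 - p + Δ) := by linarith
      _ ≤ (1 - p + Δ) ^ #𝓑 * (1 - p + Δ) := by
          refine mul_le_mul_of_nonneg_right ih' (by linarith)

end Uniform

theorem card_not_disjoint_le {α β : Type*} [DecidableEq α] (f : β → Finset α) (T : Finset β)
    (hf : (T : Set β).PairwiseDisjoint f) (Q : Finset α) :
    #{j ∈ T | ¬Disjoint Q (f j)} ≤ #Q := by
  set T' : Finset β := {j ∈ T | ¬Disjoint Q (f j)} with hT'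
  have hsub : (T' : Set β) ⊆ T := fun j hj => (Finset.mem_filter.1 hj).1
  calc #T' = ∑ j ∈ T', 1 := by simp
    _ ≤ ∑ j ∈ T', #(Q ∩ f j) := by
        refine Finset.sum_le_sum fun j hj => ?_
        rw [Nat.one_le_iff_ne_zero, Finset.card_ne_zero, ← Finset.not_disjoint_iff_nonempty_inter]
        exact (Finset.mem_filter.1 hj).2
    _ = #(T'.biUnion fun j => Q ∩ f j) := by
        rw [Finset.card_biUnion]
        exact fun a ha b hb hab => (hf (hsub ha) (hsub hb) hab).mono
          Finset.inter_subset_right Finset.inter_subset_right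
    _ ≤ #Q := Finset.card_le_card (Finset.biUnion_subset.2 fun _ _ => Finset.inter_subset_left)

/-- A system of blocks of size `w`, disjoint within each row, in which every collection of at most
`N` blocks loses at most `C` points per block to overlaps. -/
structure IsBlockSystem {n u v : ℕ} (S : Fin u → Fin v → Finset (Fin n)) (w C N : ℕ) : Prop where
  card_eq : ∀ i j, #(S i j) = w
  disjoint : ∀ i j j', j ≠ j' → Disjoint (S i j) (S i j')
  expand : ∀ J : Finset (Fin u × Fin v), #J ≤ N →
    w * #J ≤ #(J.biUnion fun b => S b.1 b.2) + C * #J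

theorem exists_isBlockSystem (n u v w N C : ℕ) (hv : 0 < v) (hn : w * v ≤ n) {y : ℝ}
    (hy : 0 ≤ y) (hyN : y * N * w ≤ v) (hC : 2 * Real.exp 1 * (u * v) ≤ (1 + y) ^ C) :
    ∃ S : Fin u → Fin v → Finset (Fin n), IsBlockSystem S w C N := by
  obtain ⟨π, hπ⟩ := exists_expanding_transversals u v w N C hv hy hyN hC
  obtain ⟨e⟩ : Nonempty (Fin w × Fin v ↪ Fin n) :=
    Function.Embedding.nonempty_of_card_le (by simpa using hn)
  refine ⟨fun i j => (transversal π (i, j)).map e, ?_, ?_, ?_⟩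
  · intro i j
    rw [Finset.card_map, transversal, Finset.card_image_of_injective, Finset.card_univ,
      Fintype.card_fin]
    intro k k' h
    exact (Prod.mk.inj h).1
  · intro i j j' hj
    rw [Finset.disjoint_map, Finset.disjoint_left]
    intro p hp hp'
    simp only [transversal, Finset.mem_image, Finset.mem_univ, true_and] at hp hp'
    obtain ⟨k, rfl⟩ := hp
    obtain ⟨k', h⟩ := hp'
    obtain ⟨rfl, h2⟩ := Prod.mk.inj h
    exact hj ((π (i, k')).injective h2).symm
  · intro J hJ
    have h : (J.biUnion fun b => (transversal π (b.1, b.2)).map e) =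
        (J.biUnion (transversal π)).map e := by
      ext x
      simp only [Finset.mem_biUnion, Finset.mem_map]
      constructor
      · rintro ⟨b, hb, p, hp, rfl⟩; exact ⟨p, ⟨b, hb, hp⟩, rfl⟩
      · rintro ⟨p, ⟨b, hb, hp⟩, rfl⟩; exact ⟨b, hb, p, hp, rfl⟩
    rw [h, Finset.card_map]
    exact hπ J hJ

theorem half_pow_le {a b c : ℕ} (h : a ≤ b + c) :
    (1 / 2 : ℝ) ^ b ≤ 2 ^ c * (1 / 2) ^ a := by
  calc (1 / 2 : ℝ) ^ b = 2 ^ c * (1 / 2) ^ (b + c) := by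
        rw [pow_add, mul_left_comm, ← mul_pow]; norm_num
    _ ≤ _ := by
        gcongr 2 ^ c * ?_
        exact pow_le_pow_of_le_one (by norm_num) (by norm_num) h

theorem choose_mul_pow_le {M k : ℕ} (hk : 0 < k) {x b : ℝ} (hx : 0 ≤ x)
    (hb : 3 * (M * x) ≤ b * k) : (M.choose k : ℝ) * x ^ k ≤ b ^ k := by
  have hkR : (0 : ℝ) < k := by exact_mod_cast hk
  have hfac : (0 : ℝ) < k.factorial := by exact_mod_cast k.factorial_pos
  have h1 : (k : ℝ) ^ k ≤ 3 ^ k * k.factorial := by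
    have h := Real.pow_div_factorial_le_exp (k : ℝ) hkR.le k
    rw [div_le_iff₀ hfac] at h
    refine h.trans ?_
    gcongr
    rw [← mul_one (k : ℝ), Real.exp_nat_mul]
    gcongr
    exact (Real.exp_one_lt_d9.trans (by norm_num)).le
  have h2 : (M.choose k : ℝ) ≤ M ^ k / k.factorial := Nat.choose_le_pow_div k M
  have hMx : 0 ≤ (M : ℝ) * x := by positivity
  have h3 : (3 * (M * x)) ^ k ≤ (b * k) ^ k := by gcongr
  have h4 : (M.choose k : ℝ) * x ^ k ≤ (M * x) ^ k / k.factorial := by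
    rw [mul_pow, mul_div_right_comm]
    gcongr
  refine h4.trans ?_
  rw [div_le_iff₀ hfac]
  have hkk : (0 : ℝ) < k ^ k := by positivity
  have hb0 : 0 ≤ b := by
    by_contra! h
    have : b * k < 0 := mul_neg_of_neg_of_pos h hkR
    linarith
  have h5 : 3 ^ k * ((M : ℝ) * x) ^ k ≤ 3 ^ k * (b ^ k * k.factorial) := by
    calc 3 ^ k * ((M : ℝ) * x) ^ k = (3 * (M * x)) ^ k := by rw [mul_pow 3]
      _ ≤ b ^ k * k ^ k := by rw [← mul_pow]; exact h3
      _ ≤ b ^ k * (3 ^ k * k.factorial) := by gcongr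
      _ = _ := by ring
  exact le_of_mul_le_mul_left h5 (by positivity)

section BlockSystem

variable {n u v w C N : ℕ} {S : Fin u → Fin v → Finset (Fin n)}

theorem IsBlockSystem.unif_avoid_bounds (hS : IsBlockSystem S w C N) (hN : 2 ≤ N)
    (I : Finset (Fin u)) (Δ : ℝ) (hΔ : Δ ≤ (1 / 2) ^ w)
    (hΔI : #I * w * (4 ^ C * ((1 / 2) ^ w) ^ 2) ≤ Δ) :
    ((1 - (1 / 2) ^ w) ^ v) ^ #I ≤ dPr (unif (Fin n))
      (fun x => ∀ b ∈ I ×ˢ (Finset.univ : Finset (Fin v)), ¬∀ k ∈ S b.1 b.2, x k = true) ∧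
    dPr (unif (Fin n))
      (fun x => ∀ b ∈ I ×ˢ (Finset.univ : Finset (Fin v)), ¬∀ k ∈ S b.1 b.2, x k = true) ≤
      ((1 - (1 / 2) ^ w + Δ) ^ v) ^ #I := by
  have hcard : #(I ×ˢ (Finset.univ : Finset (Fin v))) = v * #I := by
    rw [Finset.card_product, Finset.card_univ, Fintype.card_fin, mul_comm]
  constructor
  · refine le_of_eq_of_le ?_ (prod_le_dPr_unif_avoid (fun b : Fin u × Fin v => S b.1 b.2) _)
    simp_rw [hS.card_eq]
    rw [Finset.prod_const, hcard, pow_mul]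
  · refine (dPr_unif_avoid_le (fun b : Fin u × Fin v => S b.1 b.2) w Δ hΔ _
      (fun b _ => hS.card_eq _ _) fun a _ => ?_).trans_eq (by rw [hcard, pow_mul])
    refine le_trans ?_ hΔI
    have hpair : ∀ b ∈ I ×ˢ (Finset.univ : Finset (Fin v)),
        b ≠ a ∧ ¬Disjoint (S a.1 a.2) (S b.1 b.2) →
        (1 / 2 : ℝ) ^ #(S a.1 a.2 ∪ S b.1 b.2) ≤ 4 ^ C * ((1 / 2) ^ w) ^ 2 := by
      intro b _ hb
      have h2 : #({a, b} : Finset (Fin u × Fin v)) = 2 := Finset.card_pair hb.1.symm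
      have h := hS.expand {a, b} (h2.trans_le hN)
      rw [h2, Finset.biUnion_insert, Finset.singleton_biUnion] at h
      refine (half_pow_le h).trans_eq ?_
      rw [pow_mul (1 / 2 : ℝ), mul_comm C 2, pow_mul (2 : ℝ)]
      norm_num
    have hnum : #{b ∈ I ×ˢ (Finset.univ : Finset (Fin v)) |
        b ≠ a ∧ ¬Disjoint (S a.1 a.2) (S b.1 b.2)} ≤ #I * w := by
      refine (Finset.card_le_card (t := I.biUnion fun i =>
        ({j | ¬Disjoint (S a.1 a.2) (S i j)} : Finset (Fin v)).image fun j => (i, j)) ?_).trans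
        (Finset.card_biUnion_le_card_mul _ _ _ fun i _ => Finset.card_image_le.trans ?_)
      · rintro ⟨i, j⟩ hb
        simp only [Finset.mem_filter, Finset.mem_product, Finset.mem_univ, and_true] at hb
        simp only [Finset.mem_biUnion, Finset.mem_image, Finset.mem_filter, Finset.mem_univ,
          true_and]
        exact ⟨i, hb.1, j, hb.2.2, rfl⟩
      · rw [← hS.card_eq a.1 a.2]
        exact card_not_disjoint_le (S i) Finset.univ
          (fun j _ j' _ h => hS.disjoint i j j' h) _
    refine (Finset.sum_le_card_nsmul _ _ (4 ^ C * ((1 / 2) ^ w) ^ 2) fun b hb => ?_).trans ?_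
    · exact hpair b (Finset.mem_filter.1 hb).1 (Finset.mem_filter.1 hb).2
    · rw [nsmul_eq_mul]
      gcongr
      exact_mod_cast hnum

theorem IsBlockSystem.sum_half_pow_le (hS : IsBlockSystem S w C N) (I : Finset (Fin u)) {k : ℕ}
    (hk : k ≤ N) :
    ∑ J ∈ (I ×ˢ (Finset.univ : Finset (Fin v))).powersetCard k,
      (1 / 2 : ℝ) ^ #(J.biUnion fun b => S b.1 b.2) ≤
      (#I * v).choose k * (2 ^ C * (1 / 2) ^ w) ^ k := by
  refine (Finset.sum_le_card_nsmul _ _ ((2 ^ C * (1 / 2) ^ w) ^ k) fun J hJ => ?_).trans_eq ?_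
  · rw [Finset.mem_powersetCard] at hJ
    have h := hS.expand J (hJ.2.trans_le hk)
    rw [hJ.2] at h
    refine (half_pow_le h).trans_eq ?_
    rw [mul_pow, pow_mul, pow_mul]
  · rw [Finset.card_powersetCard, Finset.card_product, Finset.card_univ, Fintype.card_fin,
      nsmul_eq_mul]

theorem IsBlockSystem.abs_avoid_sub_unif_le (hS : IsBlockSystem S w C N) (I : Finset (Fin u))
    {k t : ℕ} (hk0 : 0 < k) (hk : k ≤ N) (hkt : k * w ≤ t) {D : (Fin n → Bool) → ℝ}
    (hD0 : ∀ x, 0 ≤ D x) (hD : kWiseIndep D t) :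
    |dPr D (fun x => ∀ b ∈ I ×ˢ (Finset.univ : Finset (Fin v)), ¬∀ k ∈ S b.1 b.2, x k = true) -
      dPr (unif (Fin n))
        (fun x => ∀ b ∈ I ×ˢ (Finset.univ : Finset (Fin v)), ¬∀ k ∈ S b.1 b.2, x k = true)| ≤
      2 * ((#I * v).choose k * (2 ^ C * (1 / 2) ^ w) ^ k) := by
  obtain ⟨s, rfl⟩ : ∃ s, k = s + 1 := ⟨k - 1, by omega⟩
  have ht : ∀ J ⊆ I ×ˢ (Finset.univ : Finset (Fin v)), #J ≤ s + 1 →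
      #(∅ ∪ J.biUnion fun b => S b.1 b.2) ≤ t := by
    intro J _ hJ
    rw [Finset.empty_union]
    exact (Finset.card_biUnion_le_card_mul J _ w fun b _ => (hS.card_eq _ _).le).trans
      (le_trans (by gcongr) hkt)
  have h1 := abs_planted_avoid_sub_le hD0 hD ∅ _ _ s ht
  have h2 := abs_planted_avoid_sub_le unif_nonneg (kWiseIndep_unif t) ∅ _ _ s ht
  have h3 := hS.sum_half_pow_le I hk
  simp only [Finset.notMem_empty, IsEmpty.forall_iff, implies_true, true_and,
    Finset.empty_union] at h1 h2
  rw [abs_sub_comm] at h2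
  refine (abs_sub_le _ _ _).trans ((add_le_add h1 h2).trans ?_)
  linarith

end BlockSystem

theorem one_sub_half_pow_pow_bounds {w : ℕ} (hw : 0 < w) :
    (1 / 4 : ℝ) ^ w ≤ (1 - (1 / 2) ^ w) ^ (w * 2 ^ w) ∧
      (1 - (1 / 2 : ℝ) ^ w) ^ (w * 2 ^ w) ≤ (1 / 2) ^ w := by
  have hp1 : (1 / 2 : ℝ) ^ w ≤ 1 / 2 := by
    simpa using pow_le_pow_of_le_one (by norm_num : (0 : ℝ) ≤ 1 / 2) (by norm_num) hw
  have hp0 : (0 : ℝ) < (1 / 2) ^ w := by positivity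
  have hp : (2 : ℝ) ^ w * (1 / 2) ^ w = 1 := by rw [← mul_pow]; norm_num
  have hbase : 0 ≤ 1 - (1 / 2 : ℝ) ^ w := by linarith
  rw [mul_comm w, pow_mul]
  constructor
  · refine pow_le_pow_left₀ (by norm_num) ?_ w
    obtain ⟨m, rfl⟩ : ∃ m, w = m + 1 := ⟨w - 1, by omega⟩
    rw [pow_succ 2 m, pow_mul]
    have h := one_add_mul_le_pow (a := -(1 / 2 : ℝ) ^ (m + 1)) (by linarith) (2 ^ m)
    have h2 : 1 / 2 ≤ (1 - (1 / 2 : ℝ) ^ (m + 1)) ^ 2 ^ m := by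
      rw [← sub_eq_add_neg] at h
      refine le_trans ?_ h
      push_cast
      rw [pow_succ] at hp
      linarith
    calc (1 / 4 : ℝ) = (1 / 2) ^ 2 := by norm_num
      _ ≤ _ := pow_le_pow_left₀ (by norm_num) h2 2
  · refine pow_le_pow_left₀ (by positivity) ?_ w
    calc (1 - (1 / 2 : ℝ) ^ w) ^ 2 ^ w ≤ Real.exp (-(1 / 2) ^ w) ^ 2 ^ w :=
          pow_le_pow_left₀ hbase (Real.one_sub_le_exp_neg _) _
      _ = Real.exp (-1) := by
          rw [← Real.exp_nat_mul]
          push_cast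
          rw [mul_neg, hp]
      _ ≤ 1 / 2 := Real.exp_neg_one_lt_half.le

theorem abs_one_sub_pow_floor_sub_half_le {ρ : ℝ} (h0 : 0 < ρ) (h1 : ρ ≤ 1 / 2) :
    |(1 - ρ) ^ ⌊Real.log 2 / ρ⌋₊ - 1 / 2| ≤ ρ := by
  set u := ⌊Real.log 2 / ρ⌋₊
  have hlog : 0 < Real.log 2 := Real.log_pos (by norm_num)
  have hlog1 : Real.log 2 ≤ 1 := Real.log_two_lt_d9.le.trans (by norm_num)
  have hu1 : u * ρ ≤ Real.log 2 := by
    rw [← le_div_iff₀ h0]; exact Nat.floor_le (by positivity)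
  have hu2 : Real.log 2 ≤ u * ρ + ρ := by
    have := (Nat.lt_floor_add_one (Real.log 2 / ρ)).le
    rw [div_le_iff₀ h0] at this
    linarith
  have hexp : Real.exp (-Real.log 2) = 1 / 2 := by
    rw [Real.exp_neg, Real.exp_log (by norm_num)]; norm_num
  rw [abs_le]
  constructor
  · have hbase : Real.exp (-(ρ / (1 - ρ))) ≤ 1 - ρ := by
      have h := Real.add_one_le_exp (ρ / (1 - ρ))
      have h2 : ρ / (1 - ρ) + 1 = (1 - ρ)⁻¹ := by
        have : 1 - ρ ≠ 0 := by linarith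
        field_simp
        ring
      rw [h2] at h
      rw [Real.exp_neg]
      exact inv_le_of_inv_le₀ (by linarith) h
    have hpow : Real.exp (-(Real.log 2) - 2 * ρ) ≤ (1 - ρ) ^ u := by
      refine le_trans ?_ (pow_le_pow_left₀ (Real.exp_pos _).le hbase u)
      rw [← Real.exp_nat_mul, Real.exp_le_exp]
      have : (u : ℝ) * (ρ / (1 - ρ)) ≤ Real.log 2 + 2 * ρ := by
        rw [← mul_div_assoc, div_le_iff₀ (by linarith)]
        nlinarith
      linarith
    rw [sub_eq_add_neg, Real.exp_add, hexp] at hpow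
    have := Real.add_one_le_exp (-(2 * ρ))
    linarith
  · have hpow : (1 - ρ) ^ u ≤ Real.exp (-(Real.log 2) + ρ) := by
      refine (pow_le_pow_left₀ (by linarith) (Real.one_sub_le_exp_neg ρ) u).trans ?_
      rw [← Real.exp_nat_mul, Real.exp_le_exp]
      linarith
    rw [Real.exp_add, hexp] at hpow
    have := (abs_le.1 (Real.abs_exp_sub_one_le (x := ρ) (by rw [abs_of_pos h0]; linarith))).2
    rw [abs_of_pos h0] at this
    linarith

section Bias

variable {n u w C N : ℕ} {S : Fin u → Fin (w * 2 ^ w) → Finset (Fin n)}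

theorem IsBlockSystem.abs_avoid_sub_le (hS : IsBlockSystem S w C N) (hw : 0 < w)
    (hη : 8 * 4 ^ C * (w : ℝ) ^ 4 * (1 / 2) ^ w ≤ 1) {t : ℕ} (hN : 2 ^ (C + 4) * w ^ 2 ≤ N)
    (ht : 2 ^ (C + 4) * w ^ 2 * w ≤ t) {D : (Fin n → Bool) → ℝ}
    (hD0 : ∀ x, 0 ≤ D x) (hD : kWiseIndep D t) {I : Finset (Fin u)} (hI : #I ≤ w + 1) :
    |dPr D (fun x => ∀ b ∈ I ×ˢ (univ : Finset (Fin (w * 2 ^ w))),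
        ¬∀ k ∈ S b.1 b.2, x k = true) - ((1 - (1 / 2) ^ w) ^ (w * 2 ^ w)) ^ #I| ≤
      3 * (8 * 4 ^ C * (w : ℝ) ^ 4 * (1 / 2) ^ w) * ((1 - (1 / 2) ^ w) ^ (w * 2 ^ w)) ^ #I := by
  obtain ⟨hρ1, -⟩ := one_sub_half_pow_pow_bounds hw
  have hp0 : (0 : ℝ) < (1 / 2) ^ w := by positivity
  have hp1 : (1 / 2 : ℝ) ^ w ≤ 1 / 2 := by
    simpa using pow_le_pow_of_le_one (by norm_num : (0 : ℝ) ≤ 1 / 2) (by norm_num) hw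
  have hp : (2 : ℝ) ^ w * (1 / 2) ^ w = 1 := by rw [← mul_pow]; norm_num
  have hw1 : (1 : ℝ) ≤ w := by exact_mod_cast hw
  have hC1 : (1 : ℝ) ≤ 2 ^ C := one_le_pow₀ (by norm_num)
  have hC4 : (1 : ℝ) ≤ 4 ^ C := one_le_pow₀ (by norm_num)
  have hm : (#I : ℝ) ≤ 2 * w := by
    have : (#I : ℝ) ≤ w + 1 := by exact_mod_cast hI
    linarith
  have hw4 : (1 : ℝ) ≤ w ^ 4 := one_le_pow₀ hw1
  have hw24 : (w : ℝ) ^ 2 ≤ w ^ 4 := pow_le_pow_right₀ hw1 (by norm_num)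
  set p : ℝ := (1 / 2) ^ w with hpdef
  set η : ℝ := 8 * 4 ^ C * (w : ℝ) ^ 4 * p with hηdef
  set ρ : ℝ := (1 - p) ^ (w * 2 ^ w) with hρdef
  have hρ0 : 0 < ρ := lt_of_lt_of_le (by positivity) hρ1
  have hη8 : 8 * p ≤ η := by
    have : 1 ≤ 4 ^ C * (w : ℝ) ^ 4 := one_le_mul_of_one_le_of_one_le hC4 hw4
    nlinarith
  have hη0 : 0 < η := by positivity
  set Δ : ℝ := 2 * w ^ 2 * 4 ^ C * p ^ 2 with hΔdef
  have hΔ0 : 0 ≤ Δ := by positivity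
  have hΔ : Δ ≤ p := by
    have h1 : 2 * (w : ℝ) ^ 2 * 4 ^ C * p ≤ 1 := by
      refine le_trans ?_ hη
      have : 4 ^ C * (w : ℝ) ^ 2 ≤ 4 ^ C * w ^ 4 := by gcongr
      rw [hηdef]
      nlinarith [mul_le_mul_of_nonneg_right this hp0.le]
    calc Δ = 2 * (w : ℝ) ^ 2 * 4 ^ C * p * p := by rw [hΔdef]; ring
      _ ≤ 1 * p := by gcongr
      _ = p := one_mul p
  have hN2 : 2 ≤ N := by
    refine le_trans ?_ hN
    have : 1 ≤ w ^ 2 := Nat.one_le_pow _ _ hw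
    have h2 : 2 ^ 1 ≤ 2 ^ (C + 4) := Nat.pow_le_pow_right (by norm_num) (by omega)
    nlinarith
  obtain ⟨hlow, hup⟩ := hS.unif_avoid_bounds hN2 I Δ hΔ (by
    calc (#I : ℝ) * w * (4 ^ C * p ^ 2) ≤ 2 * w * w * (4 ^ C * p ^ 2) := by gcongr
      _ = Δ := by rw [hΔdef]; ring)
  have hup2 : ((1 - p + Δ) ^ (w * 2 ^ w)) ^ #I ≤ ρ ^ #I * (1 + 2 * η) := by
    have h1 : 1 - p + Δ ≤ (1 - p) * Real.exp (2 * Δ) := by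
      have := Real.add_one_le_exp (2 * Δ)
      have h2 : (1 - p) * (2 * Δ + 1) ≤ (1 - p) * Real.exp (2 * Δ) := by
        gcongr; linarith
      nlinarith
    calc ((1 - p + Δ) ^ (w * 2 ^ w)) ^ #I
        ≤ (((1 - p) * Real.exp (2 * Δ)) ^ (w * 2 ^ w)) ^ #I := by
          have h0 : 0 ≤ 1 - p + Δ := by linarith
          gcongr
      _ = ρ ^ #I * Real.exp (((w * 2 ^ w : ℕ) * #I : ℝ) * (2 * Δ)) := by
          rw [mul_pow, mul_pow, ← hρdef, ← pow_mul (Real.exp _), ← Real.exp_nat_mul]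
          push_cast
          rfl
      _ ≤ ρ ^ #I * Real.exp η := by
          gcongr
          push_cast
          calc (w * 2 ^ w * #I : ℝ) * (2 * Δ) ≤ (w * 2 ^ w * (2 * w)) * (2 * Δ) := by gcongr
            _ = 8 * 4 ^ C * (w : ℝ) ^ 4 * p * (2 ^ w * p) := by rw [hΔdef]; ring
            _ = η := by rw [hp, mul_one]
      _ ≤ ρ ^ #I * (1 + 2 * η) := by
          have := (abs_le.1 (Real.abs_exp_sub_one_le (x := η) (by
            rw [abs_of_pos hη0]; exact hη))).2
          rw [abs_of_pos hη0] at this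
          gcongr
          linarith
  have hk0 : 0 < 2 ^ (C + 4) * w ^ 2 := by positivity
  have htail : ((#I * (w * 2 ^ w)).choose (2 ^ (C + 4) * w ^ 2) : ℝ) *
      (2 ^ C * p) ^ (2 ^ (C + 4) * w ^ 2) ≤ ρ ^ #I * p := by
    refine (choose_mul_pow_le (b := 1 / 2) hk0 (by positivity) ?_).trans ?_
    · push_cast
      calc 3 * (#I * (w * 2 ^ w) * (2 ^ C * p) : ℝ)
          = 3 * (#I * w * 2 ^ C) * (2 ^ w * p) := by ring
        _ = 3 * (#I * w * 2 ^ C) := by rw [hp, mul_one]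
        _ ≤ 3 * (2 * w * w * 2 ^ C) := by gcongr
        _ ≤ 1 / 2 * (2 ^ (C + 4) * w ^ 2) := by
            rw [pow_add]
            nlinarith [show (0 : ℝ) ≤ 2 ^ C * w ^ 2 by positivity]
    · calc (1 / 2 : ℝ) ^ (2 ^ (C + 4) * w ^ 2) ≤ (1 / 2) ^ (2 * (w * #I) + w) := by
            refine pow_le_pow_of_le_one (by norm_num) (by norm_num) ?_
            have h2 : 2 ^ 4 ≤ 2 ^ (C + 4) := Nat.pow_le_pow_right (by norm_num) (by omega)
            have h3 : w * #I ≤ w * (w + 1) := Nat.mul_le_mul_left _ hI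
            have h4 : 2 ^ 4 * w ^ 2 ≤ 2 ^ (C + 4) * w ^ 2 := Nat.mul_le_mul_right _ h2
            nlinarith
        _ = ((1 / 4) ^ w) ^ #I * p := by
            rw [pow_add, pow_mul, pow_mul]
            norm_num [hpdef]
        _ ≤ ρ ^ #I * p := by gcongr
  have hmom := hS.abs_avoid_sub_unif_le I hk0 hN ht hD0 hD
  rw [← hpdef] at hmom
  have hρm : 0 < ρ ^ #I := by positivity
  rw [abs_le] at hmom ⊢
  have hlow' : ρ ^ #I ≤ _ := hlow
  have hpη : 2 * (ρ ^ #I * p) ≤ ρ ^ #I * η := by nlinarith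
  constructor
  · linarith [hmom.1]
  · linarith [hmom.2]

theorem sum_inv_factorial_le (s : ℕ) : ∑ m ∈ range s, (1 / (m.factorial : ℝ)) ≤ 3 := by
  have h := Real.sum_le_exp_of_nonneg (x := 1) zero_le_one s
  simp only [one_pow] at h
  exact h.trans (Real.exp_one_lt_d9.le.trans (by norm_num))

theorem two_pow_le_factorial_succ (w : ℕ) : 2 ^ w ≤ (w + 1).factorial := by
  induction w with
  | zero => simp
  | succ w ih =>
    rw [Nat.factorial_succ, pow_succ]
    nlinarith

theorem choose_mul_pow_le_inv_factorial {u : ℕ} {ρ : ℝ} (hρ : 0 ≤ ρ) (hu : u * ρ ≤ 1) (m : ℕ) :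
    (u.choose m : ℝ) * ρ ^ m ≤ 1 / m.factorial := by
  calc (u.choose m : ℝ) * ρ ^ m ≤ u ^ m / m.factorial * ρ ^ m := by
        gcongr; exact Nat.choose_le_pow_div m u
    _ = (u * ρ) ^ m / m.factorial := by rw [mul_pow]; ring
    _ ≤ 1 / m.factorial := by
        gcongr
        exact pow_le_one₀ (by positivity) hu

theorem IsBlockSystem.abs_dPr_depth3_sub_half_le (hS : IsBlockSystem S w C N) (hw : 0 < w)
    (hη : 8 * 4 ^ C * (w : ℝ) ^ 4 * (1 / 2) ^ w ≤ 1) {t : ℕ} (hN : 2 ^ (C + 4) * w ^ 2 ≤ N)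
    (ht : 2 ^ (C + 4) * w ^ 2 * w ≤ t)
    (hu : u = ⌊Real.log 2 / (1 - (1 / 2) ^ w) ^ (w * 2 ^ w)⌋₊) {D : (Fin n → Bool) → ℝ}
    (hD0 : ∀ x, 0 ≤ D x) (hD : kWiseIndep D t) :
    |dPr D (Depth3 S) - 1 / 2| ≤ 10 * (8 * 4 ^ C * (w : ℝ) ^ 4 * (1 / 2) ^ w) := by
  obtain ⟨hρ1, hρ2⟩ := one_sub_half_pow_pow_bounds hw
  have hρ0 := lt_of_lt_of_le (by positivity) hρ1
  have hp1 : (1 / 2 : ℝ) ^ w ≤ 1 / 2 := by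
    simpa using pow_le_pow_of_le_one (by norm_num : (0 : ℝ) ≤ 1 / 2) (by norm_num) hw
  have hhalf := abs_one_sub_pow_floor_sub_half_le hρ0 (hρ2.trans hp1)
  rw [← hu] at hhalf
  have hmom := fun I => hS.abs_avoid_sub_le hw hη hN ht hD0 hD (I := I)
  have hw1 : (1 : ℝ) ≤ w := by exact_mod_cast hw
  set ρ : ℝ := (1 - (1 / 2) ^ w) ^ (w * 2 ^ w) with hρdef
  have huρ : u * ρ ≤ 1 := by
    have : (u : ℝ) ≤ Real.log 2 / ρ := hu ▸ Nat.floor_le (by positivity)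
    rw [le_div_iff₀ hρ0] at this
    exact this.trans (Real.log_two_lt_d9.le.trans (by norm_num))
  have hη8 : 8 * (1 / 2) ^ w ≤ 8 * 4 ^ C * (w : ℝ) ^ 4 * (1 / 2) ^ w := by
    have : 1 ≤ 4 ^ C * (w : ℝ) ^ 4 :=
      one_le_mul_of_one_le_of_one_le (one_le_pow₀ (by norm_num)) (one_le_pow₀ hw1)
    nlinarith [show (0 : ℝ) < (1 / 2) ^ w by positivity]
  set η : ℝ := 8 * 4 ^ C * (w : ℝ) ^ 4 * (1 / 2) ^ w with hηdef
  have hη0 : 0 ≤ η := by positivity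
  set P : Fin u → (Fin n → Bool) → Prop := fun i x => ∀ j, ¬∀ k ∈ S i j, x k = true with hP
  set A : ℕ → ℝ := fun m => ∑ J ∈ (univ : Finset (Fin u)).powersetCard m,
    dPr D (fun x => True ∧ ∀ b ∈ J, P b x) with hA
  have hAm : ∀ m ≤ w + 1, |A m - (u.choose m : ℝ) * ρ ^ m| ≤
      3 * η * ((u.choose m : ℝ) * ρ ^ m) := by
    intro m hm
    have hcard : #((univ : Finset (Fin u)).powersetCard m) = u.choose m := by simp
    have h1 : (u.choose m : ℝ) * ρ ^ m =
        ∑ J ∈ (univ : Finset (Fin u)).powersetCard m, ρ ^ m := by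
      rw [Finset.sum_const, hcard, nsmul_eq_mul]
    have h2 : 3 * η * ((u.choose m : ℝ) * ρ ^ m) =
        ∑ J ∈ (univ : Finset (Fin u)).powersetCard m, 3 * η * ρ ^ m := by
      rw [Finset.sum_const, hcard, nsmul_eq_mul]; ring
    rw [h2, h1, hA, ← Finset.sum_sub_distrib]
    refine (Finset.abs_sum_le_sum_abs _ _).trans (Finset.sum_le_sum fun J hJ => ?_)
    have hJm := (Finset.mem_powersetCard.1 hJ).2
    have h := hmom J (hJm.trans_le hm)
    rw [hJm] at h
    refine le_of_eq_of_le ?_ h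
    congr 2
    refine dPr_congr fun x => ?_
    simp only [hP, Finset.mem_product, Finset.mem_univ, and_true, true_and]
    exact ⟨fun h b hb => h b.1 hb b.2, fun h b hb j => h (b, j) hb⟩
  have hbon := abs_bonferroni_sub_le hD0 (fun _ => True) P univ w
  have hf : dPr D (Depth3 S) = dPr D (fun x => True ∧ ∀ b ∈ univ, ¬P b x) :=
    dPr_congr fun x => by simp [Depth3, hP]
  rw [← hf] at hbon
  have halt := abs_alternating_choose_sub_le hρ0.le (hρ2.trans (hp1.trans (by norm_num))) u w
  have hsum : |∑ m ∈ range (w + 1), (-1) ^ m * A m -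
      ∑ m ∈ range (w + 1), (-1) ^ m * ((u.choose m : ℝ) * ρ ^ m)| ≤ 9 * η := by
    rw [← Finset.sum_sub_distrib]
    calc _ ≤ ∑ m ∈ range (w + 1), 3 * η * (1 / (m.factorial : ℝ)) := by
          refine (Finset.abs_sum_le_sum_abs _ _).trans (Finset.sum_le_sum fun m hm => ?_)
          rw [← mul_sub, abs_mul, abs_pow, abs_neg, abs_one, one_pow, one_mul]
          refine (hAm m (Finset.mem_range.1 hm).le).trans ?_
          gcongr
          exact choose_mul_pow_le_inv_factorial hρ0.le huρ m
      _ = 3 * η * ∑ m ∈ range (w + 1), (1 / (m.factorial : ℝ)) := by rw [Finset.mul_sum]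
      _ ≤ 3 * η * 3 := by gcongr; exact sum_inv_factorial_le _
      _ = 9 * η := by ring
  have hb : (u.choose (w + 1) : ℝ) * ρ ^ (w + 1) ≤ (1 / 2) ^ w := by
    refine (choose_mul_pow_le_inv_factorial hρ0.le huρ _).trans ?_
    rw [one_div_pow]
    gcongr
    exact_mod_cast two_pow_le_factorial_succ w
  have hAw := (abs_le.1 (hAm (w + 1) le_rfl)).2
  have hb0 : 0 ≤ (u.choose (w + 1) : ℝ) * ρ ^ (w + 1) := by positivity
  have hAw' : A (w + 1) ≤ 4 * (1 / 2) ^ w := by nlinarith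
  rw [abs_le] at hbon halt hsum hhalf ⊢
  have hbon1 := hbon.1
  have hbon2 := hbon.2
  change -A (w + 1) ≤ dPr D (Depth3 S) - ∑ m ∈ range (w + 1), (-1) ^ m * A m at hbon1
  change dPr D (Depth3 S) - ∑ m ∈ range (w + 1), (-1) ^ m * A m ≤ A (w + 1) at hbon2
  constructor <;> linarith [halt.1, halt.2, hsum.1, hsum.2, hhalf.1, hhalf.2]

end Bias

section Influence

variable {n u : ℕ}

theorem UndetC.exists_touched_block {v : ℕ} {S : Fin u → Fin v → Finset (Fin n)}
    {Q : Finset (Fin n)} {x : {i : Fin n // i ∉ Q} → Bool} (h : UndetC (Depth3 S) Q x) :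
    ∃ b ∈ ({b | ¬Disjoint Q (S b.1 b.2)} : Finset (Fin u × Fin v)),
      (∀ k ∈ (S b.1 b.2).subtype (· ∉ Q), x k = true) ∧
        ∀ j ∈ ({j | Disjoint Q (S b.1 j)} : Finset (Fin v)),
          ¬∀ k ∈ (S b.1 j).subtype (· ∉ Q), x k = true := by
  obtain ⟨y, z, hy, hz, hF, hF'⟩ : ∃ y z : Fin n → Bool,
      (∀ i, ∀ h : i ∉ Q, y i = x ⟨i, h⟩) ∧ (∀ i, ∀ h : i ∉ Q, z i = x ⟨i, h⟩) ∧
        Depth3 S y ∧ ¬Depth3 S z := by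
    obtain ⟨y, z, hy, hz, hne⟩ := h
    by_cases hF : Depth3 S y
    · exact ⟨y, z, hy, hz, hF, fun h => hne (iff_of_true hF h)⟩
    · exact ⟨z, y, hz, hy, by_contra fun h => hne (iff_of_false hF h), hF⟩
  simp only [Depth3, not_forall, not_exists] at hF'
  obtain ⟨i, hi⟩ := hF'
  obtain ⟨j, hj⟩ := hF i
  refine ⟨(i, j), ?_, ?_, ?_⟩
  · simp only [Finset.mem_filter, Finset.mem_univ, true_and]
    intro hd
    obtain ⟨k, hk, hzk⟩ := hi j
    have hkQ : k ∉ Q := Finset.disjoint_right.1 hd hk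
    exact hzk ((hz k hkQ).trans ((hy k hkQ).symm.trans (hj k hk)))
  · rintro ⟨k, hkQ⟩ hk
    exact (hy k hkQ).symm.trans (hj k (Finset.mem_subtype.1 hk))
  · intro j' hj' hall
    obtain ⟨k, hk, hzk⟩ := hi j'
    have hkQ : k ∉ Q := Finset.disjoint_right.1 (Finset.mem_filter.1 hj').2 hk
    exact hzk ((hz k hkQ).trans (hall ⟨k, hkQ⟩ (Finset.mem_subtype.2 hk)))

theorem card_subtype_notMem {α : Type*} [DecidableEq α] (A Q : Finset α) :
    #(A.subtype (· ∉ Q)) = #(A \ Q) := by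
  rw [Finset.card_subtype, Finset.filter_notMem_eq_sdiff]

theorem IsBlockSystem.card_touched_le {v w C N : ℕ} {S : Fin u → Fin v → Finset (Fin n)}
    (hS : IsBlockSystem S w C N) (Q : Finset (Fin n)) :
    #({b | ¬Disjoint Q (S b.1 b.2)} : Finset (Fin u × Fin v)) ≤ u * #Q := by
  refine (Finset.card_le_card (t := (univ : Finset (Fin u)).biUnion fun i =>
    ({j | ¬Disjoint Q (S i j)} : Finset (Fin v)).image fun j => (i, j)) ?_).trans
    ((Finset.card_biUnion_le_card_mul _ _ #Q fun i _ => Finset.card_image_le.trans ?_).trans_eq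
      (by simp))
  · rintro ⟨i, j⟩ hb
    simp only [Finset.mem_filter, Finset.mem_univ, true_and] at hb
    simp only [Finset.mem_biUnion, Finset.mem_image, Finset.mem_filter, Finset.mem_univ, true_and]
    exact ⟨i, j, hb, rfl⟩
  · exact card_not_disjoint_le (S i) univ (fun j _ j' _ h => hS.disjoint i j j' h) Q

/-- Few blocks of a block system lose more than a constant number of points to a small set. -/
theorem IsBlockSystem.card_heavy_le {v w C N : ℕ} {S : Fin u → Fin v → Finset (Fin n)}
    (hS : IsBlockSystem S w C N) (hC : 0 < C) {q : ℕ} (hq : q + 1 ≤ N) {Q : Finset (Fin n)}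
    (hQ : #Q ≤ q) :
    #({b | #(S b.1 b.2 \ Q) + 2 * C ≤ w} : Finset (Fin u × Fin v)) ≤ q := by
  by_contra! h
  obtain ⟨J, hJ, hJq⟩ := Finset.exists_subset_card_eq (Nat.succ_le_of_lt h)
  have h1 := hS.expand J (hJq.trans_le hq)
  have h2 : #(J.biUnion fun b => S b.1 b.2) ≤ #Q + ∑ b ∈ J, #(S b.1 b.2 \ Q) := by
    refine (Finset.card_le_card (t := Q ∪ J.biUnion fun b => S b.1 b.2 \ Q) ?_).trans
      ((Finset.card_union_le _ _).trans (Nat.add_le_add_left Finset.card_biUnion_le _))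
    intro k hk
    simp only [Finset.mem_biUnion, Finset.mem_union, Finset.mem_sdiff] at hk ⊢
    obtain ⟨b, hb, hk⟩ := hk
    by_cases hkQ : k ∈ Q
    · exact Or.inl hkQ
    · exact Or.inr ⟨b, hb, hk, hkQ⟩
  have h3 : ∑ b ∈ J, (#(S b.1 b.2 \ Q) + 2 * C) ≤ #J * w :=
    Finset.sum_le_card_nsmul _ _ _ fun b hb => (Finset.mem_filter.1 (hJ hb)).2
  rw [Finset.sum_add_distrib, Finset.sum_const, smul_eq_mul] at h3
  rw [hJq] at h1 h3
  have : q.succ ≤ C * q.succ := Nat.le_mul_of_pos_left _ hC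
  nlinarith

theorem IsBlockSystem.sum_touched_le {v w C N : ℕ} {S : Fin u → Fin v → Finset (Fin n)}
    (hS : IsBlockSystem S w C N) (hC : 0 < C) {q : ℕ} (hq : q + 1 ≤ N) {Q : Finset (Fin n)}
    (hQ : #Q ≤ q) :
    ∑ b ∈ ({b | ¬Disjoint Q (S b.1 b.2)} : Finset (Fin u × Fin v)),
      (1 / 2 : ℝ) ^ #(S b.1 b.2 \ Q) ≤ u * q * (4 ^ C * (1 / 2) ^ w) + q := by
  set T : Finset (Fin u × Fin v) := {b | ¬Disjoint Q (S b.1 b.2)}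
  rw [← Finset.sum_filter_not_add_sum_filter T (fun b => #(S b.1 b.2 \ Q) + 2 * C ≤ w)]
  refine add_le_add ?_ ?_
  · refine (Finset.sum_le_card_nsmul _ _ (4 ^ C * (1 / 2) ^ w) fun b hb => ?_).trans ?_
    · have h := (Finset.mem_filter.1 hb).2
      refine (half_pow_le (a := w) (c := 2 * C) (by omega)).trans_eq ?_
      rw [pow_mul]
      norm_num
    · rw [nsmul_eq_mul]
      gcongr
      have h := (Finset.card_filter_le T fun b => ¬#(S b.1 b.2 \ Q) + 2 * C ≤ w).trans
        ((hS.card_touched_le Q).trans (Nat.mul_le_mul_left u hQ))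
      exact_mod_cast h
  · refine (Finset.sum_le_card_nsmul _ _ 1 fun b _ =>
      pow_le_one₀ (by norm_num) (by norm_num)).trans ?_
    rw [nsmul_eq_mul, mul_one]
    refine Nat.cast_le.2 (le_trans (Finset.card_le_card fun b hb => ?_)
      (hS.card_heavy_le hC hq hQ))
    exact Finset.mem_filter.2 ⟨Finset.mem_univ b, (Finset.mem_filter.1 hb).2⟩

variable {w C N : ℕ} {S : Fin u → Fin (w * 2 ^ w) → Finset (Fin n)}

theorem IsBlockSystem.dPr_planted_le (hS : IsBlockSystem S w C N) (hw : 0 < w) {t q : ℕ}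
    (hqw : q * (1 / 2 : ℝ) ^ w ≤ 1 / 2) (ht : 17 * w ^ 2 ≤ t) {Q : Finset (Fin n)}
    (hQ : #Q ≤ q) {D : ({i : Fin n // i ∉ Q} → Bool) → ℝ} (hD0 : ∀ x, 0 ≤ D x)
    (hD : kWiseIndep D t) {b : Fin u × Fin (w * 2 ^ w)} (hb : ¬Disjoint Q (S b.1 b.2)) :
    dPr D (fun x => (∀ k ∈ (S b.1 b.2).subtype (· ∉ Q), x k = true) ∧
        ∀ j ∈ ({j | Disjoint Q (S b.1 j)} : Finset (Fin (w * 2 ^ w))),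
          ¬∀ k ∈ (S b.1 j).subtype (· ∉ Q), x k = true) ≤
      4 * (1 - (1 / 2) ^ w) ^ (w * 2 ^ w) * (1 / 2) ^ #(S b.1 b.2 \ Q) := by
  obtain ⟨hρ1, -⟩ := one_sub_half_pow_pow_bounds hw
  have hp0 : (0 : ℝ) < (1 / 2) ^ w := by positivity
  have hp1 : (1 / 2 : ℝ) ^ w ≤ 1 / 2 := by
    simpa using pow_le_pow_of_le_one (by norm_num : (0 : ℝ) ≤ 1 / 2) (by norm_num) hw
  have hp : (2 : ℝ) ^ w * (1 / 2) ^ w = 1 := by rw [← mul_pow]; norm_num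
  set 𝓑 : Finset (Fin (w * 2 ^ w)) := {j | Disjoint Q (S b.1 j)} with h𝓑
  have hdisj : ∀ j j', j ≠ j' →
      Disjoint ((S b.1 j).subtype (· ∉ Q)) ((S b.1 j').subtype (· ∉ Q)) := by
    intro j j' hj
    rw [Finset.disjoint_left]
    intro k hk hk'
    exact Finset.disjoint_left.1 (hS.disjoint b.1 j j' hj) (Finset.mem_subtype.1 hk)
      (Finset.mem_subtype.1 hk')
  have hcardV : #((S b.1 b.2).subtype (· ∉ Q)) ≤ w := by
    rw [card_subtype_notMem]
    exact (Finset.card_le_card Finset.sdiff_subset).trans_eq (hS.card_eq b.1 b.2)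
  have hs : 16 * w - 1 + 1 = 16 * w := by omega
  have hmain := abs_planted_avoid_disjoint_sub_le hD0 hD ((S b.1 b.2).subtype (· ∉ Q))
    (fun j => (S b.1 j).subtype (· ∉ Q)) 𝓑 (16 * w - 1) w
    (fun j hj => by
      rw [card_subtype_notMem, Finset.sdiff_eq_self_of_disjoint
        (Finset.mem_filter.1 hj).2.symm, hS.card_eq])
    (fun j hj => hdisj _ _ fun h => hb (h ▸ (Finset.mem_filter.1 hj).2))
    (fun j _ j' _ h => hdisj j j' h)
    (by rw [hs]; nlinarith)
  rw [hs, card_subtype_notMem] at hmain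
  have hsplit : #𝓑 + #({j | ¬Disjoint Q (S b.1 j)} : Finset (Fin (w * 2 ^ w))) = w * 2 ^ w := by
    rw [h𝓑, Finset.card_filter_add_card_filter_not, Finset.card_univ, Fintype.card_fin]
  have htouch := (card_not_disjoint_le (S b.1) univ
    (fun j _ j' _ h => hS.disjoint b.1 j j' h) Q).trans hQ
  set r := #({j | ¬Disjoint Q (S b.1 j)} : Finset (Fin (w * 2 ^ w)))
  have hpow : (1 - (1 / 2 : ℝ) ^ w) ^ #𝓑 ≤ 2 * (1 - (1 / 2) ^ w) ^ (w * 2 ^ w) := by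
    have hadd : (1 - (1 / 2 : ℝ) ^ w) ^ (w * 2 ^ w) =
        (1 - (1 / 2) ^ w) ^ #𝓑 * (1 - (1 / 2) ^ w) ^ r := by
      conv_lhs => rw [← hsplit]
      rw [pow_add]
    rw [hadd]
    have hbern := one_add_mul_le_pow (a := -(1 / 2 : ℝ) ^ w) (by linarith) r
    rw [← sub_eq_add_neg] at hbern
    have hr : (r : ℝ) * (1 / 2) ^ w ≤ 1 / 2 := by
      refine le_trans ?_ hqw
      gcongr
    have h0 : 0 ≤ (1 - (1 / 2 : ℝ) ^ w) ^ #𝓑 := pow_nonneg (by linarith) _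
    nlinarith
  have htail : ((#𝓑).choose (16 * w) : ℝ) * ((1 / 2) ^ w) ^ (16 * w) ≤
      (1 - (1 / 2) ^ w) ^ (w * 2 ^ w) := by
    refine (choose_mul_pow_le (b := 1 / 4) (by omega) hp0.le ?_).trans (le_trans ?_ hρ1)
    · have hle : (#𝓑 : ℝ) ≤ w * 2 ^ w := by exact_mod_cast (Nat.le_add_right _ r).trans_eq hsplit
      calc 3 * ((#𝓑 : ℝ) * (1 / 2) ^ w) ≤ 3 * (w * 2 ^ w * (1 / 2) ^ w) := by gcongr
        _ = 3 * w := by rw [mul_assoc (w : ℝ), hp, mul_one]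
        _ ≤ 1 / 4 * (16 * w : ℕ) := by
            push_cast
            nlinarith [show (0 : ℝ) ≤ w from Nat.cast_nonneg w]
    · exact pow_le_pow_of_le_one (by norm_num) (by norm_num) (by omega)
  have hV : (0 : ℝ) < (1 / 2) ^ #(S b.1 b.2 \ Q) := by positivity
  have h1 := mul_le_mul_of_nonneg_left hpow hV.le
  have h2 := mul_le_mul_of_nonneg_left htail hV.le
  have h3 := (abs_le.1 hmain).2
  linarith

theorem IsBlockSystem.dPr_undetC_le (hS : IsBlockSystem S w C N) (hw : 0 < w) (hC : 0 < C)
    {t q : ℕ} (hq : q + 1 ≤ N) (hqw : q * (1 / 2 : ℝ) ^ w ≤ 1 / 2) (ht : 17 * w ^ 2 ≤ t)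
    (hu : u * (1 - (1 / 2 : ℝ) ^ w) ^ (w * 2 ^ w) ≤ 1) {Q : Finset (Fin n)} (hQ : #Q ≤ q)
    {D : ({i : Fin n // i ∉ Q} → Bool) → ℝ} (hD0 : ∀ x, 0 ≤ D x) (hD : kWiseIndep D t) :
    dPr D (UndetC (Depth3 S) Q) ≤ 8 * 4 ^ C * (1 / 2) ^ w * q := by
  obtain ⟨hρ1, hρ2⟩ := one_sub_half_pow_pow_bounds hw
  have hρ0 := lt_of_lt_of_le (by positivity) hρ1
  refine (dPr_mono hD0 fun x hx => hx.exists_touched_block).trans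
    ((dPr_exists_le hD0 _ _).trans ((Finset.sum_le_sum fun b hb =>
      hS.dPr_planted_le hw hqw ht hQ hD0 hD (Finset.mem_filter.1 hb).2).trans ?_))
  rw [← Finset.mul_sum]
  refine (mul_le_mul_of_nonneg_left (hS.sum_touched_le hC hq hQ) (by positivity)).trans ?_
  set ρ : ℝ := (1 - (1 / 2) ^ w) ^ (w * 2 ^ w)
  have hC4 : (1 : ℝ) ≤ 4 ^ C := one_le_pow₀ (by norm_num)
  have h1 : ρ ≤ 4 ^ C * (1 / 2) ^ w := by
    nlinarith [show (0 : ℝ) < (1 / 2) ^ w by positivity]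
  have hX : 0 ≤ (4 : ℝ) ^ C * (1 / 2) ^ w * q := by positivity
  calc 4 * ρ * (u * q * (4 ^ C * (1 / 2) ^ w) + q)
      = 4 * (u * ρ * (4 ^ C * (1 / 2) ^ w * q) + ρ * q) := by ring
    _ ≤ 4 * (1 * (4 ^ C * (1 / 2) ^ w * q) + 4 ^ C * (1 / 2) ^ w * q) := by gcongr
    _ = _ := by ring

end Influence

theorem eventually_mul_logb_pow_le (K : ℝ) (k : ℕ) {s : ℝ} (hs : 0 < s) :
    ∀ᶠ x : ℝ in Filter.atTop, K * Real.logb 2 x ^ k ≤ x ^ s := by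
  have h := ((isLittleO_log_rpow_rpow_atTop (k : ℝ) hs).const_mul_left
    (K / Real.log 2 ^ k)).bound one_pos
  filter_upwards [h, Filter.eventually_ge_atTop 0] with x hx hx0
  rw [one_mul, Real.norm_of_nonneg (Real.rpow_nonneg hx0 s), Real.rpow_natCast] at hx
  calc K * Real.logb 2 x ^ k = K / Real.log 2 ^ k * Real.log x ^ k := by
        rw [Real.logb, div_pow]; ring
    _ ≤ x ^ s := (le_abs_self _).trans hx

theorem floor_mul_logb_bounds {x a : ℝ} (hx : 4 ≤ x) (ha0 : 0 ≤ a) (ha1 : a ≤ 1 / 2) :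
    0 < ⌊(1 - a) * Real.logb 2 x⌋₊ ∧
    (⌊(1 - a) * Real.logb 2 x⌋₊ : ℝ) ≤ Real.logb 2 x ∧
    (2 : ℝ) ^ ⌊(1 - a) * Real.logb 2 x⌋₊ ≤ x ^ (1 - a) ∧
    (1 / 2 : ℝ) ^ ⌊(1 - a) * Real.logb 2 x⌋₊ ≤ 2 * x ^ (-(1 - a)) := by
  have hx0 : 0 < x := by linarith
  have hL : 2 ≤ Real.logb 2 x := by
    rw [Real.le_logb_iff_rpow_le (by norm_num) hx0]
    norm_num [hx]
  set L := Real.logb 2 x with hLdef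
  have hpow : (2 : ℝ) ^ ((1 - a) * L) = x ^ (1 - a) := by
    rw [mul_comm, Real.rpow_mul (by norm_num), hLdef,
      Real.rpow_logb (by norm_num) (by norm_num) hx0]
  have hle := Nat.floor_le (show 0 ≤ (1 - a) * L by nlinarith)
  have hlt := Nat.lt_floor_add_one ((1 - a) * L)
  have h1 : 1 ≤ (1 - a) * L := by nlinarith
  refine ⟨Nat.floor_pos.2 h1, hle.trans (by nlinarith), ?_, ?_⟩
  · rw [← Real.rpow_natCast, ← hpow]
    exact Real.rpow_le_rpow_of_exponent_le (by norm_num) hle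
  · rw [Real.rpow_neg hx0.le, ← hpow, one_div, inv_pow, ← div_eq_mul_inv,
      inv_le_comm₀ (by positivity) (by positivity), inv_div, div_le_iff₀ (by norm_num),
      ← pow_succ, ← Real.rpow_natCast]
    refine Real.rpow_le_rpow_of_exponent_le (by norm_num) ?_
    push_cast
    exact hlt.le

set_option maxHeartbeats 1000000 in
theorem statement14 (δ : ℝ) (hδ0 : 0 < δ) (hδ1 : δ < 1) :
    ∃ cδ γ : ℝ, 1 ≤ cδ ∧ 0 < γ ∧ ∃ n0 : ℕ, ∀ n : ℕ, n0 ≤ n →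
      ∃ u v : ℕ, 0 < u ∧ 0 < v ∧ ∃ S : Fin u → Fin v → Finset (Fin n),
        ((∑ i, ∑ j, ((S i j).card : ℝ)) ≤ (n : ℝ) ^ cδ) ∧
        ∀ t : ℕ, cδ * (Real.logb 2 n)^4 ≤ (t:ℝ) →
          ((∀ D : (Fin n → Bool) → ℝ, (∀ x, 0 ≤ D x) → (∑ x, D x) = 1 →
              kWiseIndep D t → |dPr D (Depth3 S) - 1/2| ≤ (n:ℝ) ^ (-γ)) ∧
           (∀ q : ℕ, 1 ≤ q → (q:ℝ) ≤ (n:ℝ) ^ (1 - δ) →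
             ∀ Q : Finset (Fin n), Q.card ≤ q →
               ∀ D : ({i : Fin n // i ∉ Q} → Bool) → ℝ,
                 (∀ x, 0 ≤ D x) → (∑ x, D x) = 1 → kWiseIndep D t →
                 dPr D (UndetC (Depth3 S) Q) ≤ cδ * (n:ℝ) ^ (-(1 - δ)) * q)) := by
  obtain ⟨a, rfl⟩ : ∃ a, δ = 4 * a := ⟨δ / 4, by ring⟩
  have ha0 : 0 < a := by linarith
  have ha1 : a < 1 / 4 := by linarith
  set C : ℕ := ⌈5 / a⌉₊ with hCdef
  have hC5 : 5 ≤ a * C := by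
    rw [← div_le_iff₀' ha0]; exact Nat.le_ceil _
  have hC0 : 0 < C := Nat.ceil_pos.2 (by positivity)
  have hC2 : (0 : ℝ) < 2 ^ (C + 4) := by positivity
  have hC4 : (0 : ℝ) < 16 * 4 ^ C := by positivity
  refine ⟨2 ^ (C + 4) + 17 + 16 * 4 ^ C, 1 / 4, by linarith, by norm_num, ?_⟩
  have hev := ((((((eventually_mul_logb_pow_le 1 2 ha0).and
    (eventually_mul_logb_pow_le 2 0 ha0)).and
    (eventually_mul_logb_pow_le (6 * 2 ^ C) 0 one_pos)).and
    (eventually_mul_logb_pow_le 1 1 one_pos)).and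
    (eventually_mul_logb_pow_le (2 ^ (C + 4)) 2 one_half_pos)).and
    (eventually_mul_logb_pow_le (160 * 4 ^ C) 4 one_half_pos)).and
    (Filter.eventually_ge_atTop 4)
  obtain ⟨n0, hn0⟩ := Filter.eventually_atTop.1
    ((tendsto_natCast_atTop_atTop (R := ℝ)).eventually hev)
  refine ⟨n0, fun n hn => ?_⟩
  obtain ⟨⟨⟨⟨⟨⟨hE1, hE2⟩, hE3⟩, hE4⟩, hE5⟩, hE6⟩, hx4⟩ := hn0 n hn
  obtain ⟨hw0, hwL, hw2, hwp⟩ := floor_mul_logb_bounds hx4 ha0.le (by linarith)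
  simp only [pow_zero, mul_one, Real.rpow_one, pow_one, one_mul] at hE1 hE2 hE3 hE4
  set x : ℝ := (n : ℝ) with hx
  set L := Real.logb 2 x
  set w := ⌊(1 - a) * L⌋₊
  have hx1 : 1 ≤ x := by linarith
  have hx0 : 0 < x := by linarith
  have hw1 : (1 : ℝ) ≤ w := by exact_mod_cast hw0
  have hL1 : 1 ≤ L := hw1.trans hwL
  have hxa : 0 < x ^ a := Real.rpow_pos_of_pos hx0 a
  have hmono : ∀ {b c : ℝ}, b ≤ c → x ^ b ≤ x ^ c :=
    fun h => Real.rpow_le_rpow_of_exponent_le hx1 h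
  obtain ⟨hρ1, hρ2⟩ := one_sub_half_pow_pow_bounds hw0
  have hρ0 := lt_of_lt_of_le (by positivity) hρ1
  have hp1 : (1 / 2 : ℝ) ^ w ≤ 1 / 2 := by
    simpa using pow_le_pow_of_le_one (by norm_num : (0 : ℝ) ≤ 1 / 2) (by norm_num) hw0
  set ρ : ℝ := (1 - (1 / 2) ^ w) ^ (w * 2 ^ w) with hρdef
  set u : ℕ := ⌊Real.log 2 / ρ⌋₊ with hu
  have huρ' : u * ρ ≤ Real.log 2 := by
    rw [← le_div_iff₀ hρ0]
    exact Nat.floor_le (div_nonneg (Real.log_nonneg (by norm_num)) hρ0.le)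
  have huρ : u * ρ ≤ 1 := huρ'.trans (Real.log_two_lt_d9.le.trans (by norm_num))
  have hu0 : 0 < u := by
    rw [hu, Nat.floor_pos, one_le_div₀ hρ0]
    exact (hρ2.trans hp1).trans (le_trans (by norm_num) Real.log_two_gt_d9.le)
  have hux : (u : ℝ) ≤ x ^ 2 := by
    have h1 : (u : ℝ) * (1 / 4) ^ w ≤ 1 := (mul_le_mul_of_nonneg_left hρ1 (by positivity)).trans huρ
    have h2 : (u : ℝ) ≤ 4 ^ w := by
      rw [one_div, inv_pow, ← div_eq_mul_inv, div_le_one (by positivity)] at h1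
      exact h1
    refine h2.trans ?_
    calc (4 : ℝ) ^ w = (2 ^ w) ^ 2 := by rw [← pow_mul, mul_comm, pow_mul]; norm_num
      _ ≤ (x ^ (1 : ℝ)) ^ 2 := by
          gcongr
          exact hw2.trans (hmono (by linarith))
      _ = x ^ 2 := by rw [Real.rpow_one]
  have hwv : (w : ℝ) * (w * 2 ^ w) ≤ x := by
    calc (w : ℝ) * (w * 2 ^ w) = w ^ 2 * 2 ^ w := by ring
      _ ≤ L ^ 2 * x ^ (1 - a) := by gcongr
      _ ≤ x ^ a * x ^ (1 - a) := by gcongr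
      _ = x := by rw [← Real.rpow_add hx0]; simp
  have hvx : (w : ℝ) * 2 ^ w ≤ x := by
    exact (le_mul_of_one_le_left (by positivity) hw1).trans hwv
  set N : ℕ := ⌊x ^ (1 - 2 * a)⌋₊ with hN
  have hNle : (N : ℝ) ≤ x ^ (1 - 2 * a) := Nat.floor_le (by positivity)
  have hkN : 2 ^ (C + 4) * w ^ 2 ≤ N := by
    refine Nat.le_floor ?_
    push_cast
    calc (2 : ℝ) ^ (C + 4) * w ^ 2 ≤ 2 ^ (C + 4) * L ^ 2 := by gcongr
      _ ≤ x ^ (1 / 2 : ℝ) := hE5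
      _ ≤ x ^ (1 - 2 * a) := hmono (by linarith)
  have hN0 : 0 < N := lt_of_lt_of_le (by positivity) hkN
  have hN0' : (0 : ℝ) < N := by exact_mod_cast hN0
  have h2w : x ^ (1 - a) ≤ 2 * 2 ^ w := by
    rw [Real.rpow_neg hx0.le, one_div, inv_pow, ← div_eq_mul_inv,
      le_div_iff₀ (Real.rpow_pos_of_pos hx0 _), inv_mul_le_iff₀ (by positivity)] at hwp
    linarith
  have hy : x ^ a / 2 ≤ 2 ^ w / N := by
    rw [div_le_div_iff₀ (by norm_num) hN0']
    calc x ^ a * N ≤ x ^ a * x ^ (1 - 2 * a) := by gcongr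
      _ = x ^ (1 - a) := by rw [← Real.rpow_add hx0]; ring_nf
      _ ≤ _ := by linarith
  obtain ⟨S, hS⟩ := exists_isBlockSystem n u (w * 2 ^ w) w N C (by positivity)
    (by rw [hx] at hwv; exact_mod_cast hwv) (y := 2 ^ w / N) (by positivity)
    (by push_cast; rw [div_mul_cancel₀ _ hN0'.ne', mul_comm]) (by
      push_cast
      have he : Real.exp 1 ≤ 3 := Real.exp_one_lt_d9.le.trans (by norm_num)
      calc 2 * Real.exp 1 * (u * (w * 2 ^ w)) ≤ 2 * 3 * (x ^ 2 * x) := by gcongr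
        _ ≤ x ^ 5 / 2 ^ C := by
            rw [le_div_iff₀ (by positivity)]
            calc 2 * 3 * (x ^ 2 * x) * 2 ^ C = 6 * 2 ^ C * x ^ 3 := by ring
              _ ≤ x * x ^ 3 := by gcongr
              _ = x ^ 4 := by ring
              _ ≤ x ^ 5 := pow_le_pow_right₀ hx1 (by norm_num)
        _ ≤ (x ^ a) ^ C / 2 ^ C := by
            gcongr
            rw [← Real.rpow_natCast, ← Real.rpow_natCast, ← Real.rpow_mul hx0.le]
            exact hmono (by exact_mod_cast hC5)
        _ = (x ^ a / 2) ^ C := by rw [div_pow]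
        _ ≤ (1 + 2 ^ w / N) ^ C := by
            gcongr
            linarith)
  refine ⟨u, w * 2 ^ w, hu0, by positivity, S, ?_, fun t ht => ⟨?_, ?_⟩⟩
  · simp_rw [hS.card_eq]
    simp only [Finset.sum_const, Finset.card_univ, Fintype.card_fin, nsmul_eq_mul]
    push_cast
    calc (u : ℝ) * (w * 2 ^ w * w) = u * (w * (w * 2 ^ w)) := by ring
      _ ≤ x ^ 2 * x := by gcongr
      _ = x ^ (3 : ℝ) := by norm_cast
      _ ≤ _ := hmono (by linarith)
  · intro D hD0 _ hD
    have hη : 10 * (8 * 4 ^ C * (w : ℝ) ^ 4 * (1 / 2) ^ w) ≤ x ^ (-(1 / 4) : ℝ) := by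
      calc 10 * (8 * 4 ^ C * (w : ℝ) ^ 4 * (1 / 2) ^ w)
          ≤ 10 * (8 * 4 ^ C * L ^ 4 * (2 * x ^ (-(1 - a)))) := by gcongr
        _ = 160 * 4 ^ C * L ^ 4 * x ^ (-(1 - a)) := by ring
        _ ≤ x ^ (1 / 2 : ℝ) * x ^ (-(3 / 4) : ℝ) := by
            gcongr
            linarith
        _ = x ^ (-(1 / 4) : ℝ) := by rw [← Real.rpow_add hx0]; norm_num
    have hx14 : x ^ (-(1 / 4) : ℝ) ≤ 1 := Real.rpow_le_one_of_one_le_of_nonpos hx1 (by norm_num)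
    have hη0 : 0 ≤ 8 * 4 ^ C * (w : ℝ) ^ 4 * (1 / 2) ^ w := by positivity
    refine (hS.abs_dPr_depth3_sub_half_le hw0 (by linarith) hkN ?_ hu hD0 hD).trans hη
    rw [← Nat.cast_le (α := ℝ)]
    push_cast
    calc (2 : ℝ) ^ (C + 4) * w ^ 2 * w = 2 ^ (C + 4) * w ^ 3 := by ring
      _ ≤ 2 ^ (C + 4) * L ^ 4 := by
          gcongr ?_ * ?_
          exact (pow_le_pow_left₀ (by positivity) hwL 3).trans (pow_le_pow_right₀ hL1 (by norm_num))
      _ ≤ (2 ^ (C + 4) + 17 + 16 * 4 ^ C) * L ^ 4 := by gcongr; linarith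
      _ ≤ t := ht
  · intro q _ hq Q hQ D hD0 _ hD
    have hqN : q + 1 ≤ N := by
      refine Nat.le_floor ?_
      push_cast
      have h1 : 1 ≤ x ^ (1 - 4 * a) := Real.one_le_rpow hx1 (by linarith)
      have h2 : x ^ a ≤ x ^ (2 * a) := hmono (by linarith)
      calc (q : ℝ) + 1 ≤ x ^ (1 - 4 * a) * x ^ (2 * a) := by
            have h3 := mul_le_mul_of_nonneg_left (hE2.trans h2) (zero_le_one.trans h1)
            linarith
        _ = x ^ (1 - 2 * a) := by rw [← Real.rpow_add hx0]; ring_nf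
    have hqp : q * (1 / 2 : ℝ) ^ w ≤ 1 / 2 := by
      have h2 : x ^ (3 * a) ≥ 4 := by
        calc (4 : ℝ) ≤ x ^ a * x ^ a := by
              have h3 := mul_le_mul hE2 hE2 zero_le_two hxa.le
              linarith
          _ = x ^ (2 * a) := by rw [← Real.rpow_add hx0]; ring_nf
          _ ≤ x ^ (3 * a) := hmono (by linarith)
      calc q * (1 / 2 : ℝ) ^ w ≤ x ^ (1 - 4 * a) * (2 * x ^ (-(1 - a))) := by gcongr
        _ = 2 * (x ^ (1 - 4 * a) * x ^ (-(1 - a))) := by ring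
        _ = 2 * (x ^ (3 * a))⁻¹ := by
            rw [← Real.rpow_add hx0, ← Real.rpow_neg hx0.le]; ring_nf
        _ ≤ 2 * 4⁻¹ := by gcongr
        _ = 1 / 2 := by norm_num
    have ht17 : 17 * w ^ 2 ≤ t := by
      rw [← Nat.cast_le (α := ℝ)]
      push_cast
      calc (17 : ℝ) * w ^ 2 ≤ 17 * L ^ 4 := by
            gcongr ?_ * ?_
            exact (pow_le_pow_left₀ (by positivity) hwL 2).trans
              (pow_le_pow_right₀ hL1 (by norm_num))
        _ ≤ (2 ^ (C + 4) + 17 + 16 * 4 ^ C) * L ^ 4 := by gcongr; linarith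
        _ ≤ t := ht
    refine (hS.dPr_undetC_le hw0 hC0 hqN hqp ht17 huρ hQ hD0 hD).trans ?_
    refine mul_le_mul_of_nonneg_right ?_ (Nat.cast_nonneg q)
    calc 8 * 4 ^ C * (1 / 2 : ℝ) ^ w ≤ 8 * 4 ^ C * (2 * x ^ (-(1 - a))) := by gcongr
      _ = 16 * 4 ^ C * x ^ (-(1 - a)) := by ring
      _ ≤ (2 ^ (C + 4) + 17 + 16 * 4 ^ C) * x ^ (-(1 - 4 * a)) := by
          gcongr
          · linarith
          · linarith
end

section
/- Let c, ℓ, w, v, D be positive integers with 3·c < w − ℓ and D dividing v, and identify [v] with [D]×[v/D] via (z,e) ↦ z + D·(e−1). Let G_c:[v]^c → [v]^{2c} be a function such that for all x ≠ x', the shift-Hamming distance (with shifts mod v) between G_c(x) and G_c(x') is at least c, and let G_ℓ:[D]^ℓ → [D]^{w−2c} be a function such that for all y ≠ y', the shift-Hamming distance (with shifts mod D) between G_ℓ(y) and G_ℓ(y') is at least w−2c−ℓ. Let E:[v^c]×[D] → [v/D] be any function, and define 𝒰:[v^c]×[D]^ℓ → [v]^w by 𝒰(x,y)_i = G_c(x)_i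 for 1 ≤ i ≤ 2c and 𝒰(x,y)_i = ( G_ℓ(y)_{i−2c} , E(x, G_ℓ(y)_{i−2c}) ) ∈ [D]×[v/D] ≅ [v] for 2c < i ≤ w. Then the collection of partitions { P^{𝒰(x,y)} : (x,y) ∈ [v^c]×[D]^ℓ } (indexed by (x,y)) is a (c, w−2c−ℓ, D^{−ℓ})-design: for all (x,y) ≠ (x',y') and all i,j ∈ [v], |P^{𝒰(x,y)}_i ∩ P^{𝒰(x',y')}_j| ≤ w−c, and for every fixed (x,y), i, j, Pr over a uniform index (x',y') that |P^{𝒰(x,y)}_i ∩ P^{𝒰(x',y')}_j| ≤ 2c+ℓ is at least 1 − D^{−ℓ}. -/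
open Finset

/-- Probability of event `E` under the uniform distribution on a finite type. -/
noncomputable def uPr {α : Type*} [Fintype α] (E : α → Prop) : ℝ :=
  (Nat.card {x // E x} : ℝ) / (Fintype.card α)

/-- The `i`-th block of the partition `P^α` of `[v·w]` associated to `α ∈ (ℤ/v)^w`:
`P^α_i = { (k−1)·v + ((i − α_k) mod v) : k ∈ [w] }` (0-indexed). -/
def blockP {v w : ℕ} (α : Fin w → ZMod v) (i : Fin v) : Finset (Fin (v * w)) :=
  Finset.univ.image (fun k : Fin w =>
    (⟨k.1 * v + ((((i.1 : ZMod v) - α k).val) % v), by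
      have hv : 0 < v := Nat.lt_of_le_of_lt (Nat.zero_le _) i.2
      have h1 : ((((i.1 : ZMod v) - α k).val) % v) < v := Nat.mod_lt _ hv
      have h2 : k.1 + 1 ≤ w := k.2
      calc k.1 * v + ((((i.1 : ZMod v) - α k).val) % v) < k.1 * v + v := by omega
        _ = (k.1 + 1) * v := by ring
        _ ≤ w * v := Nat.mul_le_mul h2 (Nat.le_refl v)
        _ = v * w := Nat.mul_comm w v⟩ : Fin (v * w)))

/-- The identification `[D] × [v/D] ≅ [v]`, `(z,e) ↦ z + D·e` (0-indexed), as residues mod `v`. -/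
def encodeZ (v D : ℕ) (z : ZMod D) (e : ZMod (v / D)) : ZMod v :=
  ((z.val + D * e.val : ℕ) : ZMod v)

/-- The string `𝒰(x,y) ∈ [v]^w`: first `2c` coordinates from `Gc x`, remaining coordinates
the pairs `(Gl(y)_i, E(x, Gl(y)_i)) ∈ [D] × [v/D] ≅ [v]`. -/
def Ufun {v D c ℓ w : ℕ} (Gc : (Fin c → ZMod v) → Fin (2*c) → ZMod v)
    (Gl : (Fin ℓ → ZMod D) → Fin (w - 2*c) → ZMod D)
    (E : (Fin c → ZMod v) → ZMod D → ZMod (v / D))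
    (x : Fin c → ZMod v) (y : Fin ℓ → ZMod D) : Fin w → ZMod v :=
  fun i =>
    if h : i.1 < 2*c then Gc x ⟨i.1, h⟩
    else encodeZ v D (Gl y ⟨i.1 - 2*c, by have := i.2; omega⟩)
      (E x (Gl y ⟨i.1 - 2*c, by have := i.2; omega⟩))

theorem zmod_eq_of_mul_add_eq {v k k' : ℕ} (hv : 0 < v) {a b : ZMod v}
    (h : k * v + a.val % v = k' * v + b.val % v) : k = k' ∧ a = b := by
  have : NeZero v := ⟨hv.ne'⟩
  rw [Nat.mod_eq_of_lt a.val_lt, Nat.mod_eq_of_lt b.val_lt] at h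
  have hdiv := congrArg (· / v) h
  have hmod := congrArg (· % v) h
  simp only [mul_comm _ v, Nat.mul_add_div hv, Nat.mul_add_mod, Nat.div_eq_of_lt (ZMod.val_lt _),
    add_zero, Nat.mod_eq_of_lt (ZMod.val_lt _)] at hdiv hmod
  exact ⟨hdiv, ZMod.val_injective v hmod⟩

/-- Blocks of `P^α` and `P^β` meet only at positions where `α - β` equals the shift `i - j`. -/
theorem card_blockP_inter_le {v w : ℕ} (α β : Fin w → ZMod v) (i j : Fin v) :
    (blockP α i ∩ blockP β j).card ≤
      (univ.filter fun k => α k - β k = (i.1 : ZMod v) - (j.1 : ZMod v)).card := by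
  classical
  have hv : 0 < v := i.pos
  have hsub : blockP α i ∩ blockP β j ⊆
      (univ.filter fun k => α k - β k = (i.1 : ZMod v) - (j.1 : ZMod v)).image
        (fun k : Fin w => (⟨k.1 * v + (((i.1 : ZMod v) - α k).val % v), by
          have h1 : ((i.1 : ZMod v) - α k).val % v < v := Nat.mod_lt _ hv
          have h2 : (k.1 + 1) * v ≤ w * v := Nat.mul_le_mul_right v k.2
          have h3 := Nat.mul_comm w v
          have h4 : (k.1 + 1) * v = k.1 * v + v := by ring
          omega⟩ : Fin (v * w))) := by
    intro e he
    simp only [blockP, mem_inter, mem_image, mem_univ, true_and] at he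
    obtain ⟨⟨k, rfl⟩, k', hk'⟩ := he
    obtain ⟨hkk, hab⟩ := zmod_eq_of_mul_add_eq hv (Fin.mk.inj hk')
    obtain rfl : k' = k := Fin.ext hkk
    refine mem_image.2 ⟨k', mem_filter.2 ⟨mem_univ _, ?_⟩, rfl⟩
    linear_combination hab
  exact (card_le_card hsub).trans card_image_le

theorem card_filter_add_le_of_card_filter_ne {n m : ℕ} {R : Type*} [DecidableEq R]
    {f : Fin n → R} {a : R} (h : m ≤ (univ.filter fun k => f k ≠ a).card) :
    (univ.filter fun k => f k = a).card + m ≤ n := by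
  have := card_filter_add_card_filter_not (s := (univ : Finset (Fin n))) (fun k => f k = a)
  simp only [card_univ, Fintype.card_fin] at this
  change m ≤ (univ.filter fun k => ¬ f k = a).card at h
  omega

theorem castHom_encodeZ {v D : ℕ} [NeZero D] (hdvd : D ∣ v) (z : ZMod D) (e : ZMod (v / D)) :
    ZMod.castHom hdvd (ZMod D) (encodeZ v D z e) = z := by
  rw [encodeZ, map_natCast]
  simp

theorem card_filter_Ufun_sub_le {v D c ℓ w : ℕ} [NeZero D] (hw : 2 * c ≤ w) (hdvd : D ∣ v)
    (Gc : (Fin c → ZMod v) → Fin (2*c) → ZMod v)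
    (Gl : (Fin ℓ → ZMod D) → Fin (w - 2*c) → ZMod D)
    (E : (Fin c → ZMod v) → ZMod D → ZMod (v / D))
    (x x' : Fin c → ZMod v) (y y' : Fin ℓ → ZMod D) (a : ZMod v) :
    (univ.filter fun k => Ufun Gc Gl E x y k - Ufun Gc Gl E x' y' k = a).card ≤
      (univ.filter fun k => Gc x k - Gc x' k = a).card +
      (univ.filter fun k => Gl y k - Gl y' k = ZMod.castHom hdvd (ZMod D) a).card := by
  classical
  have hsub : (univ.filter fun k => Ufun Gc Gl E x y k - Ufun Gc Gl E x' y' k = a) ⊆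
      (univ.filter fun k => Gc x k - Gc x' k = a).image (Fin.castLE hw) ∪
      (univ.filter fun k => Gl y k - Gl y' k = ZMod.castHom hdvd (ZMod D) a).image
        (fun k => (⟨k.1 + 2 * c, by omega⟩ : Fin w)) := by
    intro k hk
    replace hk := (mem_filter.1 hk).2
    rw [mem_union, mem_image, mem_image]
    by_cases h : k.1 < 2 * c
    · simp only [Ufun, h, dif_pos] at hk
      exact Or.inl ⟨⟨k.1, h⟩, mem_filter.2 ⟨mem_univ _, hk⟩, rfl⟩
    · simp only [Ufun, h, dif_neg, not_false_eq_true] at hk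
      refine Or.inr ⟨⟨k.1 - 2 * c, by omega⟩, mem_filter.2 ⟨mem_univ _, ?_⟩, ?_⟩
      · rw [← hk, map_sub, castHom_encodeZ, castHom_encodeZ]
      · exact Fin.ext (Nat.sub_add_cancel (not_lt.1 h))
  exact (card_le_card hsub).trans ((card_union_le _ _).trans
    (add_le_add card_image_le card_image_le))

/-- An event on a product that holds whenever the second coordinate avoids `b` has probability
at least `1 - 1/|β|`. -/
theorem one_sub_inv_card_le_uPr {α β : Type*} [Fintype α] [Fintype β] [Nonempty α]
    (b : β) (E : α × β → Prop) (hE : ∀ p, p.2 ≠ b → E p) :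
    1 - 1 / (Fintype.card β : ℝ) ≤ uPr E := by
  classical
  have hα : (0 : ℝ) < Fintype.card α := by exact_mod_cast Fintype.card_pos
  have hβ : (0 : ℝ) < Fintype.card β := by exact_mod_cast Fintype.card_pos_iff.2 ⟨b⟩
  have hcompl : Fintype.card {p // ¬ E p} ≤ Fintype.card α :=
    Fintype.card_le_of_injective (fun p => p.1.1) fun p q hpq => by
      have hp : p.1.2 = b := by_contra fun h => p.2 (hE _ h)
      have hq : q.1.2 = b := by_contra fun h => q.2 (hE _ h)
      exact Subtype.ext (Prod.ext hpq (hp.trans hq.symm))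
  have hle := Fintype.card_subtype_le E
  rw [Fintype.card_subtype_compl] at hcompl
  have hcard : Fintype.card α * Fintype.card β ≤ Fintype.card {p // E p} + Fintype.card α := by
    rw [← Fintype.card_prod]
    omega
  have hcard' : (Fintype.card α : ℝ) * Fintype.card β ≤
      Fintype.card {p // E p} + Fintype.card α := by exact_mod_cast hcard
  rw [uPr, Nat.card_eq_fintype_card, Fintype.card_prod, Nat.cast_mul, le_div_iff₀ (by positivity)]
  have : (1 - 1 / (Fintype.card β : ℝ)) * (Fintype.card α * Fintype.card β) =
      Fintype.card α * Fintype.card β - Fintype.card α := by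
    field_simp
  linarith

theorem statement15 (v D c ℓ w : ℕ) [NeZero v] [NeZero D] [NeZero (v / D)]
    (hc : 0 < c) (hℓ : 0 < ℓ) (h3c : 3*c < w - ℓ) (hℓw : ℓ < w) (hdvd : D ∣ v)
    (Gc : (Fin c → ZMod v) → Fin (2*c) → ZMod v)
    -- any two distinct codewords of `Gc` have shift-Hamming distance ≥ c
    (hGc : ∀ x x', x ≠ x' → ∀ a : ZMod v,
      c ≤ (Finset.univ.filter (fun i => Gc x i - Gc x' i ≠ a)).card)
    (Gl : (Fin ℓ → ZMod D) → Fin (w - 2*c) → ZMod D)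
    -- any two distinct codewords of `Gl` have shift-Hamming distance ≥ w − 2c − ℓ
    (hGl : ∀ y y', y ≠ y' → ∀ a : ZMod D,
      w - 2*c - ℓ ≤ (Finset.univ.filter (fun i => Gl y i - Gl y' i ≠ a)).card)
    (E : (Fin c → ZMod v) → ZMod D → ZMod (v / D)) :
    -- `{P^{𝒰(x,y)}}` is a `(c, w−2c−ℓ, D^{−ℓ})`-design:
    (∀ p p' : (Fin c → ZMod v) × (Fin ℓ → ZMod D), p ≠ p' → ∀ i j : Fin v,
      ((blockP (Ufun Gc Gl E p.1 p.2) i) ∩ (blockP (Ufun Gc Gl E p'.1 p'.2) j)).card ≤ w - c) ∧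
    (∀ p : (Fin c → ZMod v) × (Fin ℓ → ZMod D), ∀ i j : Fin v,
      1 - 1/(D:ℝ)^ℓ ≤
        uPr (fun p' : (Fin c → ZMod v) × (Fin ℓ → ZMod D) =>
          ((blockP (Ufun Gc Gl E p.1 p.2) i) ∩
            (blockP (Ufun Gc Gl E p'.1 p'.2) j)).card ≤ 2*c + ℓ)) := by
  have hinter (p p' : (Fin c → ZMod v) × (Fin ℓ → ZMod D)) (i j : Fin v) :=
    (card_blockP_inter_le (Ufun Gc Gl E p.1 p.2) (Ufun Gc Gl E p'.1 p'.2) i j).trans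
      (card_filter_Ufun_sub_le (by omega) hdvd Gc Gl E p.1 p'.1 p.2 p'.2 _)
  have hsmall (p p' : (Fin c → ZMod v) × (Fin ℓ → ZMod D)) (i j : Fin v) (hy : p.2 ≠ p'.2) :
      (blockP (Ufun Gc Gl E p.1 p.2) i ∩ blockP (Ufun Gc Gl E p'.1 p'.2) j).card ≤ 2*c + ℓ := by
    refine (hinter p p' i j).trans (add_le_add (card_finset_fin_le _) ?_)
    have := card_filter_add_le_of_card_filter_ne
      (hGl p.2 p'.2 hy (ZMod.castHom hdvd (ZMod D) ((i.1 : ZMod v) - (j.1 : ZMod v))))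
    omega
  refine ⟨fun p p' hne i j => ?_, fun p i j => ?_⟩
  · by_cases hy : p.2 = p'.2
    · have hx : p.1 ≠ p'.1 := fun hx => hne (Prod.ext hx hy)
      have hfirst := card_filter_add_le_of_card_filter_ne
        (hGc p.1 p'.1 hx ((i.1 : ZMod v) - (j.1 : ZMod v)))
      have hlast := card_finset_fin_le (univ.filter fun k => Gl p.2 k - Gl p'.2 k =
        ZMod.castHom hdvd (ZMod D) ((i.1 : ZMod v) - (j.1 : ZMod v)))
      have := hinter p p' i j
      omega
    · have := hsmall p p' i j hy
      omega
  · have hcard : (Fintype.card (Fin ℓ → ZMod D) : ℝ) = (D : ℝ) ^ ℓ := by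
      simp [ZMod.card]
    rw [← hcard]
    exact one_sub_inv_card_le_uPr p.2 _ fun p' hp' => hsmall p p' i j hp'.symm
end

section
/- There exists a universal constant C ≥ 1 such that the following holds. Let w, v, u be integers with 1 ≤ w ≤ v ≤ u and let B ≥ 1 be a real number with 0 ≤ v − 2^w·ln(u/ln 2) ≤ B. Put θ = (1 − 2^{−w})^v. Then (1 + θ)^u ≤ C and | (1 − θ)^u − 1/2 | ≤ C·B·(ln u)·2^{−w}. -/
theorem exp_neg_sub_sq_le_one_sub {x : ℝ} (h0 : 0 ≤ x) (h1 : x ≤ 1 / 2) :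
    Real.exp (-(x + x ^ 2)) ≤ 1 - x := by
  have hq := Real.quadratic_le_exp_of_nonneg (x := x + x ^ 2) (by positivity)
  rw [Real.exp_neg, inv_le_iff_one_le_mul₀ (Real.exp_pos _)]
  have h2 : 0 ≤ 1 - x - x ^ 2 - x ^ 3 := by nlinarith [pow_le_pow_left₀ h0 h1 2, pow_le_pow_left₀ h0 h1 3]
  have h3 : (1 - x) * (1 + (x + x ^ 2) + (x + x ^ 2) ^ 2 / 2) ≤
      (1 - x) * Real.exp (x + x ^ 2) :=
    mul_le_mul_of_nonneg_left hq (by linarith)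
  nlinarith [mul_nonneg (sq_nonneg x) h2]

theorem exp_neg_mul_sub_sq_le_one_sub_pow {x : ℝ} (h0 : 0 ≤ x) (h1 : x ≤ 1 / 2) (n : ℕ) :
    Real.exp (-(n * (x + x ^ 2))) ≤ (1 - x) ^ n := by
  have h := pow_le_pow_left₀ (Real.exp_pos _).le (exp_neg_sub_sq_le_one_sub h0 h1) n
  rwa [← Real.exp_nat_mul, mul_neg] at h

theorem one_sub_pow_le_exp_neg_mul {x : ℝ} (h1 : x ≤ 1) (n : ℕ) :
    (1 - x) ^ n ≤ Real.exp (-(n * x)) := by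
  have h := pow_le_pow_left₀ (by linarith) (Real.one_sub_le_exp_neg x) n
  rwa [← Real.exp_nat_mul, mul_neg] at h

theorem statement18 :
    ∃ C : ℝ, 1 ≤ C ∧
      ∀ (w v u : ℕ) (B : ℝ), 1 ≤ w → w ≤ v → v ≤ u → 1 ≤ B →
        0 ≤ (v:ℝ) - 2^w * Real.log ((u:ℝ) / Real.log 2) →
        (v:ℝ) - 2^w * Real.log ((u:ℝ) / Real.log 2) ≤ B →
        (1 + (1 - (1/2:ℝ)^w)^v)^u ≤ C ∧
        |(1 - (1 - (1/2:ℝ)^w)^v)^u - 1/2| ≤ C * B * Real.log u * (1/2:ℝ)^w := by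
  refine ⟨10, by norm_num, fun w v u B hw hwv hvu hB hb0 hbB => ?_⟩
  have hL1 := Real.log_two_gt_d9
  have hL2 := Real.log_two_lt_d9
  have hexpL : Real.exp (-Real.log 2) = 1 / 2 := by
    rw [Real.exp_neg, Real.exp_log two_pos, one_div]
  rcases (by omega : u = 1 ∨ 2 ≤ u) with rfl | hu
  · obtain rfl : v = 1 := by omega
    obtain rfl : w = 1 := by omega
    norm_num
  have hu2 : (2:ℝ) ≤ u := by exact_mod_cast hu
  have hu0 : (0:ℝ) < u := by linarith
  have hvu' : (v:ℝ) ≤ u := by exact_mod_cast hvu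
  have hN : (1/2:ℝ)^w * 2^w = 1 := by rw [← mul_pow]; norm_num
  have he0 : 0 < (1/2:ℝ)^w := by positivity
  have he1 : (1/2:ℝ)^w ≤ 1/2 := by
    simpa using pow_le_pow_of_le_one (by norm_num : (0:ℝ) ≤ 1/2) (by norm_num) hw
  have hN0 : (0:ℝ) < 2^w := by positivity
  set L := Real.log 2 with hL
  set e := (1/2:ℝ)^w with he
  set N := (2:ℝ)^w with hNdef
  set l := Real.log ((u:ℝ) / L) with hl
  have hL0 : 0 < L := by linarith
  have hlu : L ≤ Real.log u := Real.log_le_log two_pos hu2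
  have hlexp : Real.exp l = u / L := Real.exp_log (by positivity)
  have hl1 : 1 ≤ l := by
    rw [hl, Real.le_log_iff_exp_le (by positivity), le_div_iff₀ hL0]
    nlinarith [Real.exp_one_lt_d9, Real.exp_one_gt_d9]
  have hl2 : l ≤ Real.log u + 1 := by
    rw [hl, Real.log_div hu0.ne' hL0.ne']
    have : -1 ≤ Real.log L := by
      rw [Real.le_log_iff_exp_le hL0, Real.exp_neg,
        inv_le_comm₀ (Real.exp_pos _) hL0]
      have : L⁻¹ ≤ 2 := by rw [inv_le_comm₀ hL0 two_pos]; linarith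
      linarith [Real.exp_one_gt_d9]
    linarith
  have hev1 : l ≤ e * v := by nlinarith
  have hev2 : e * v ≤ l + e * B := by nlinarith
  have huN : 1 ≤ e * u := by nlinarith
  have hinv : 1 / (u:ℝ) ≤ e := by rwa [div_le_iff₀ hu0]
  set θ := (1 - e) ^ v with hθ
  have hθ0 : 0 ≤ θ := pow_nonneg (by linarith) _
  have hexpl : Real.exp (-l) = L / u := by rw [Real.exp_neg, hlexp, inv_div]
  have hθL : θ ≤ L / u := by
    rw [← hexpl]
    refine (one_sub_pow_le_exp_neg_mul (by linarith) v).trans (Real.exp_le_exp.2 ?_)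
    linarith
  have hLu : L / u ≤ 1 / 2 := by rw [div_le_iff₀ hu0]; linarith
  have huθ : u * θ ≤ L := by rwa [le_div_iff₀ hu0, mul_comm] at hθL
  have hx0 : 0 ≤ u * θ := by positivity
  have hBl : L * B ≤ B * Real.log u := by
    linarith [mul_le_mul_of_nonneg_left hlu (by linarith : 0 ≤ B)]
  have hlB : Real.log u ≤ B * Real.log u := le_mul_of_one_le_left (by linarith) hB
  constructor
  · have h := pow_le_pow_left₀ (by linarith) (by linarith [Real.add_one_le_exp θ] : 1 + θ ≤ Real.exp θ) u
    rw [← Real.exp_nat_mul] at h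
    have h2 := Real.exp_le_exp.2 huθ
    rw [Real.exp_log two_pos] at h2
    linarith
  rw [abs_le]
  constructor
  · have h1 := pow_le_pow_left₀ (by linarith) (by linarith : 1 - L / u ≤ 1 - θ) u
    have h2 := exp_neg_mul_sub_sq_le_one_sub_pow (by positivity : 0 ≤ L / u) hLu u
    have h3 : -(u * (L / u + (L / u) ^ 2)) = -L + -(L ^ 2 * (1 / u)) := by field_simp; ring
    rw [h3, Real.exp_add, hexpL] at h2
    have h4 := Real.add_one_le_exp (-(L ^ 2 * (1 / u)))
    have h5 : L ^ 2 * (1 / u) ≤ e := by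
      have h : L ^ 2 ≤ 1 := pow_le_one₀ hL0.le (by linarith)
      linarith [mul_le_mul_of_nonneg_right h (one_div_pos.2 hu0).le]
    have h6 : e ≤ 10 * B * Real.log u * e :=
      le_mul_of_one_le_left he0.le (by linarith)
    linarith
  · have h1 := one_sub_pow_le_exp_neg_mul (by linarith : θ ≤ 1) u
    have h2 : Real.exp (-(u * θ)) - 1 / 2 ≤ L - u * θ := by
      have h := Real.add_one_le_exp (-(L - u * θ))
      have h' : Real.exp (-(u * θ)) * Real.exp (-(L - u * θ)) = 1 / 2 := by
        rw [← Real.exp_add, ← hexpL]; ring_nf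
      have hle : Real.exp (-(u * θ)) ≤ 1 := Real.exp_le_one_iff.2 (by linarith)
      linarith [mul_le_mul_of_nonneg_left h (Real.exp_pos (-(u * θ))).le,
        mul_le_mul_of_nonneg_right hle (by linarith : 0 ≤ L - u * θ)]
    have h3 : L * (1 - (e * B + e * (l + e * B))) ≤ u * θ := by
      have h := exp_neg_mul_sub_sq_le_one_sub_pow he0.le he1 v
      have hle : -l + -(e * B + e * (l + e * B)) ≤ -(v * (e + e ^ 2)) := by
        linarith [mul_le_mul_of_nonneg_left hev2 he0.le]
      have h' := (Real.exp_le_exp.2 hle).trans h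
      rw [Real.exp_add, hexpl, div_mul_eq_mul_div, div_le_iff₀ hu0] at h'
      have h4 := Real.add_one_le_exp (-(e * B + e * (l + e * B)))
      linarith [mul_le_mul_of_nonneg_left h4 hL0.le]
    have h4 : e * B + e * (l + e * B) ≤ 10 * B * Real.log u * e := by
      have h5 : B + (l + e * B) ≤ 10 * B * Real.log u := by
        linarith [mul_le_mul_of_nonneg_right he1 (by linarith : 0 ≤ B),
          mul_le_mul_of_nonneg_right hL1.le (by linarith : 0 ≤ B)]
      linarith [mul_le_mul_of_nonneg_left h5 he0.le]
    have h6 : 0 ≤ e * B + e * (l + e * B) := by positivity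
    linarith [mul_le_mul_of_nonneg_right (by linarith : L ≤ 1) h6]
end

section
/- Let w be a positive integer, let A ≥ 0 and let a_1,…,a_w be real numbers with 0 ≤ a_i ≤ A for all i, and let ℓ be an integer with 1 ≤ ℓ ≤ w. Then ∏_{i=1}^w (1 + a_i) ≤ Σ_{i=0}^{ℓ−1} S_i(a_1,…,a_w) + (1 + A)^w · S_ℓ(a_1,…,a_w). -/
open Finset

theorem sum_powersetCard_succ_insert_prod {ι R : Type*} [DecidableEq ι] [CommSemiring R]
    {x : ι} {s : Finset ι} (hx : x ∉ s) (f : ι → R) (n : ℕ) :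
    ∑ I ∈ powersetCard (n + 1) (insert x s), ∏ j ∈ I, f j =
      ∑ I ∈ powersetCard (n + 1) s, ∏ j ∈ I, f j +
        f x * ∑ I ∈ powersetCard n s, ∏ j ∈ I, f j := by
  have hmem : ∀ I ∈ powersetCard n s, x ∉ I := fun I hI hxI =>
    hx ((mem_powersetCard.1 hI).1 hxI)
  rw [powersetCard_succ_insert hx, sum_union, sum_image, mul_sum]
  · congr 1
    exact sum_congr rfl fun I hI => prod_insert (hmem I hI)
  · intro I hI J hJ h
    rw [← erase_insert (hmem I hI), ← erase_insert (hmem J hJ)]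
    exact congrArg (fun t => t.erase x) h
  · rw [disjoint_left]
    intro I hI hI'
    obtain ⟨J, -, rfl⟩ := mem_image.1 hI'
    exact hx ((mem_powersetCard.1 hI).1 (mem_insert_self x J))

theorem prod_one_add_le_sum_range_add {ι : Type*} [DecidableEq ι] {A : ℝ} (hA : 0 ≤ A)
    {a : ι → ℝ} (ha : ∀ i, 0 ≤ a i ∧ a i ≤ A) (s : Finset ι) (n : ℕ) :
    ∏ i ∈ s, (1 + a i) ≤
      ∑ i ∈ range n, ∑ I ∈ powersetCard i s, ∏ j ∈ I, a j +
        (1 + A) ^ #s * ∑ I ∈ powersetCard n s, ∏ j ∈ I, a j := by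
  have hS : ∀ (t : Finset ι) (k : ℕ), 0 ≤ ∑ I ∈ powersetCard k t, ∏ j ∈ I, a j := fun t k =>
    sum_nonneg fun I _ => prod_nonneg fun j _ => (ha j).1
  have hzero : ∀ t : Finset ι, ∏ i ∈ t, (1 + a i) ≤ (1 + A) ^ #t := fun t =>
    (prod_le_prod (fun i _ => by linarith [(ha i).1]) fun i _ => by linarith [(ha i).2]).trans_eq
      (prod_const (1 + A))
  induction s using Finset.induction_on generalizing n with
  | empty =>
    cases n with
    | zero => simp
    | succ n =>
      rw [sum_range_succ']
      have h : 0 ≤ ∑ i ∈ range n, ∑ I ∈ powersetCard (i + 1) (∅ : Finset ι), ∏ j ∈ I, a j :=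
        sum_nonneg fun i _ => hS ∅ (i + 1)
      simp only [prod_empty, card_empty, pow_zero, one_mul, powersetCard_zero, sum_singleton]
      linarith [hS ∅ (n + 1)]
  | insert x s hx ih =>
    cases n with
    | zero => simpa using hzero (insert x s)
    | succ n =>
      have h₁ := ih (n + 1)
      have h₂ := mul_le_mul_of_nonneg_left (ih n) (ha x).1
      have hpow : (1 + A) ^ #s ≤ (1 + A) ^ #(insert x s) :=
        pow_le_pow_right₀ (by linarith) (card_le_card (subset_insert x s))
      have h₃ := mul_le_mul_of_nonneg_right hpow (hS (insert x s) (n + 1))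
      rw [sum_range_succ'] at h₁ ⊢
      simp only [sum_powersetCard_succ_insert_prod hx, sum_add_distrib, ← mul_sum] at h₃ ⊢
      simp only [powersetCard_zero, sum_singleton, prod_empty] at h₁ ⊢
      rw [prod_insert hx]
      linarith

theorem statement19 (w : ℕ) (hw : 0 < w) (A : ℝ) (hA : 0 ≤ A)
    (a : Fin w → ℝ) (ha : ∀ i, 0 ≤ a i ∧ a i ≤ A)
    (ℓ : ℕ) (hℓ1 : 1 ≤ ℓ) (hℓw : ℓ ≤ w) :
    (∏ i, (1 + a i)) ≤
      (∑ i ∈ Finset.range ℓ,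
        ∑ I ∈ Finset.powersetCard i (Finset.univ : Finset (Fin w)), ∏ j ∈ I, a j) +
      (1 + A)^w *
        ∑ I ∈ Finset.powersetCard ℓ (Finset.univ : Finset (Fin w)), ∏ j ∈ I, a j := by
  simpa using prod_one_add_le_sum_range_add hA ha univ ℓ
end
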